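/- Let n ≥ 1 and 1 < p < ∞. There exists a constant C > 0, depending only on n and p, such that for every u ∈ C^∞(B₁) and f ∈ C^∞(B₁) satisfying Δu = f pointwise in B₁, one has ∫_{B_{1/2}} |D²u|^p ≤ C (∫_{B₁} |u|^p + ∫_{B₁} |f|^p), where the integrals are taken in [0,∞]. -/

import Mathlib

open MeasureTheory Metric

/-- Partial derivative of `u : ℝⁿ → ℝ` in the `i`-th coordinate direction. -/
noncomputable def partialDeriv' {n : ℕ} (i : Fin n)
    (u : EuclideanSpace ℝ (Fin n) → ℝ) : EuclideanSpace ℝ (Fin n) → ℝ :=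
  fun x => fderiv ℝ u x (EuclideanSpace.single i 1)

/-- Entry `(i, j)` of the Hessian matrix `D²u`, i.e. `∂_j ∂_i u`. -/
noncomputable def hessEntry {n : ℕ} (u : EuclideanSpace ℝ (Fin n) → ℝ)
    (i j : Fin n) : EuclideanSpace ℝ (Fin n) → ℝ :=
  partialDeriv' j (partialDeriv' i u)

/-- Squared Frobenius norm `|D²u(x)|²` of the Hessian. -/
noncomputable def hessFrobSq {n : ℕ} (u : EuclideanSpace ℝ (Fin n) → ℝ)
    (x : EuclideanSpace ℝ (Fin n)) : ℝ :=
  ∑ i, ∑ j, (hessEntry u i j x) ^ 2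

/-- Laplacian `Δu = tr D²u`. -/
noncomputable def lap {n : ℕ} (u : EuclideanSpace ℝ (Fin n) → ℝ)
    (x : EuclideanSpace ℝ (Fin n)) : ℝ :=
  ∑ i, hessEntry u i i x

theorem fderiv_fderiv_apply_eq_of_line {E : Type*} [NormedAddCommGroup E] [NormedSpace ℝ E]
    {f : E → ℝ} (hf : ContDiff ℝ 2 f) (z w : E) {g : ℝ → ℝ} {d : ℝ}
    (hg : ∀ y, HasDerivAt (fun y : ℝ => f (z + y • w)) (g y) y) (hd : HasDerivAt g d 0) :
    fderiv ℝ (fderiv ℝ f) z w w = d := by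
  have hline : ∀ y : ℝ, HasDerivAt (fun y : ℝ => z + y • w) w y := fun y => by
    simpa using ((hasDerivAt_id y).smul_const w).const_add z
  have hf1 : Differentiable ℝ f := hf.differentiable (by norm_num)
  have hf2 : ContDiff ℝ 1 (fderiv ℝ f) := hf.fderiv_right (by norm_num)
  have h1 : g = fun y => fderiv ℝ f (z + y • w) w := by
    funext y
    exact (hg y).unique ((hf1 _).hasFDerivAt.comp_hasDerivAt y (hline y))
  have h2 : HasDerivAt (fun y : ℝ => fderiv ℝ f (z + y • w) w)
      (fderiv ℝ (fderiv ℝ f) (z + (0 : ℝ) • w) w w) 0 := by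
    have := ((hf2.differentiable (by norm_num)) (z + (0 : ℝ) • w)).hasFDerivAt.comp_hasDerivAt
      (0 : ℝ) (hline 0)
    exact ((ContinuousLinearMap.apply ℝ ℝ w).hasFDerivAt.comp_hasDerivAt (0 : ℝ) this)
  rw [← h1] at h2
  simpa using (h2.unique hd)

theorem hasDerivAt_sq_add_rpow {ε : ℝ} (hε : 0 < ε) (r t b y : ℝ) :
    HasDerivAt (fun y : ℝ => ((t + y * b) ^ 2 + ε) ^ r)
      (r * ((t + y * b) ^ 2 + ε) ^ (r - 1) * (2 * (t + y * b) * b)) y := by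
  have h0 : HasDerivAt (fun y : ℝ => t + y * b) b y := by
    simpa using ((hasDerivAt_id y).mul_const b).const_add t
  have h1 := (h0.pow 2).add_const ε
  have hpos : (t + y * b) ^ 2 + ε ≠ 0 := by positivity
  have := h1.rpow_const (p := r) (Or.inl hpos)
  refine HasDerivAt.congr_deriv this ?_
  simp only [Pi.pow_apply]
  push_cast; ring

theorem hasDerivAt_deriv_sq_add_rpow {ε : ℝ} (hε : 0 < ε) (r t b y : ℝ) :
    HasDerivAt (fun y : ℝ => r * ((t + y * b) ^ 2 + ε) ^ (r - 1) * (2 * (t + y * b) * b))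
      (4 * r * (r - 1) * ((t + y * b) ^ 2 + ε) ^ (r - 2) * ((t + y * b) * b) ^ 2
        + 2 * r * ((t + y * b) ^ 2 + ε) ^ (r - 1) * b ^ 2) y := by
  have h0 : HasDerivAt (fun y : ℝ => t + y * b) b y := by
    simpa using ((hasDerivAt_id y).mul_const b).const_add t
  have h1 := ((hasDerivAt_sq_add_rpow hε (r - 1) t b y).const_mul r).mul
    ((h0.const_mul 2).mul_const b)
  refine HasDerivAt.congr_deriv h1 ?_
  rw [show r - 1 - 1 = r - 2 by ring]; ring

theorem hasDerivAt_sqrt_sq_add_sq {M N M' N' : ℝ → ℝ} {y : ℝ}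
    (hM : HasDerivAt M (M' y) y) (hN : HasDerivAt N (N' y) y) (h0 : 0 < N y) :
    HasDerivAt (fun y => √(M y ^ 2 + N y ^ 2))
      ((M y * M' y + N y * N' y) / √(M y ^ 2 + N y ^ 2)) y := by
  have := ((hM.pow 2).add (hN.pow 2)).sqrt (by simp; positivity)
  refine HasDerivAt.congr_deriv this ?_
  simp only [Pi.pow_apply, Pi.add_apply]
  have : √(M y ^ 2 + N y ^ 2) ≠ 0 := by positivity
  push_cast; field_simp

theorem hasDerivAt_deriv_sqrt_sq_add_sq {M N M' N' : ℝ → ℝ} {M'' N'' y : ℝ}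
    (hM : HasDerivAt M (M' y) y) (hN : HasDerivAt N (N' y) y)
    (hM' : HasDerivAt M' M'' y) (hN' : HasDerivAt N' N'' y) (h0 : 0 < N y) :
    HasDerivAt (fun y => (M y * M' y + N y * N' y) / √(M y ^ 2 + N y ^ 2))
      ((M y * M'' + N y * N'') / √(M y ^ 2 + N y ^ 2)
        + (M y * N' y - N y * M' y) ^ 2 / √(M y ^ 2 + N y ^ 2) ^ 3) y := by
  have hpos : 0 < M y ^ 2 + N y ^ 2 := by positivity
  have hG : √(M y ^ 2 + N y ^ 2) ≠ 0 := (Real.sqrt_pos.2 hpos).ne'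
  have := ((hM.mul hM').add (hN.mul hN')).div (hasDerivAt_sqrt_sq_add_sq hM hN h0) hG
  refine HasDerivAt.congr_deriv this ?_
  simp only [Pi.mul_apply, Pi.add_apply]
  have hs := Real.sq_sqrt hpos.le
  set G := √(M y ^ 2 + N y ^ 2)
  field_simp
  rw [hs]; ring

/-- A regularised Bellman function of Nazarov–Treil type. -/
noncomputable def bellman (p q A ε : ℝ) (z : ℝ × ℝ) : ℝ :=
  A * (z.1 ^ 2 + ε) ^ (p / 2) + A * (z.2 ^ 2 + ε) ^ (q / 2) +
    √(((z.2 ^ 2 + ε) ^ (1 / 2 : ℝ) * z.1) ^ 2 + ((z.2 ^ 2 + ε) ^ (q / 2)) ^ 2)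

theorem contDiff_bellman (p q A : ℝ) {ε : ℝ} (hε : 0 < ε) : ContDiff ℝ 2 (bellman p q A ε) := by
  have h1 : ∀ z : ℝ × ℝ, z.1 ^ 2 + ε ≠ 0 := fun z => by positivity
  have h2 : ∀ z : ℝ × ℝ, z.2 ^ 2 + ε ≠ 0 := fun z => by positivity
  have c1 : ContDiff ℝ 2 (fun z : ℝ × ℝ => z.1 ^ 2 + ε) := by fun_prop
  have c2 : ContDiff ℝ 2 (fun z : ℝ × ℝ => z.2 ^ 2 + ε) := by fun_prop
  have h3 : ∀ z : ℝ × ℝ, ((z.2 ^ 2 + ε) ^ (1 / 2 : ℝ) * z.1) ^ 2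
      + ((z.2 ^ 2 + ε) ^ (q / 2)) ^ 2 ≠ 0 := fun z => by positivity
  unfold bellman
  refine ((contDiff_const.mul (c1.rpow_const_of_ne h1)).add
    (contDiff_const.mul (c2.rpow_const_of_ne h2))).add (ContDiff.sqrt ?_ h3)
  exact (((c2.rpow_const_of_ne h2).mul contDiff_fst).pow 2).add ((c2.rpow_const_of_ne h2).pow 2)

theorem bellman_hessian_arith {q R N s t a b : ℝ} (hR : 0 < R) (hN : 0 < N) (hq1 : 1 < q)
    (hq2 : q ≤ 2) (ht : t ^ 2 ≤ R ^ 2) {G N₂ : ℝ} (hG : 0 < G)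
    (hG2 : G ^ 2 = (R * s) ^ 2 + N ^ 2) (hN2 : 0 ≤ N₂) :
    -2 * |a * b| + (if (R * s) ^ 2 ≤ N ^ 2 then R ^ 2 / N * a ^ 2 / 8 else 0)
        - N / R ^ 2 * b ^ 2 ≤
      (R * s * ((R ^ 2 - t ^ 2) * b ^ 2 / R ^ 3 * s + 2 * (t * b / R) * a) + N * N₂) / G
      + (R * s * (q * t * b * N / R ^ 2) - N * (t * b / R * s + R * a)) ^ 2 / G ^ 3 := by
  have e1 : -2 * |a * b| ≤
      (R * s * ((R ^ 2 - t ^ 2) * b ^ 2 / R ^ 3 * s + 2 * (t * b / R) * a) + N * N₂) / G := by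
    rw [le_div_iff₀ hG]
    have h1 : R * s * ((R ^ 2 - t ^ 2) * b ^ 2 / R ^ 3 * s + 2 * (t * b / R) * a)
        = (R ^ 2 - t ^ 2) * (b * s) ^ 2 / R ^ 2 + 2 * (s * t * (a * b)) := by
      field_simp
    have h2 : 0 ≤ (R ^ 2 - t ^ 2) * (b * s) ^ 2 / R ^ 2 :=
      div_nonneg (mul_nonneg (by linarith) (sq_nonneg _)) (sq_nonneg _)
    have h3 : |s * t| ≤ G := by
      apply abs_le_of_sq_le_sq _ hG.le
      nlinarith [mul_nonneg (sub_nonneg.2 ht) (sq_nonneg s), sq_nonneg N]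
    have h4 : -(|s * t| * |a * b|) ≤ s * t * (a * b) := by
      rw [← abs_mul]; exact neg_abs_le _
    have h5 : |s * t| * |a * b| ≤ G * |a * b| := by gcongr
    have h6 : 0 ≤ N * N₂ := by positivity
    rw [h1]; nlinarith
  have e2 : (if (R * s) ^ 2 ≤ N ^ 2 then R ^ 2 / N * a ^ 2 / 8 else 0) - N / R ^ 2 * b ^ 2 ≤
      (R * s * (q * t * b * N / R ^ 2) - N * (t * b / R * s + R * a)) ^ 2 / G ^ 3 := by
    have hk : R * s * (q * t * b * N / R ^ 2) - N * (t * b / R * s + R * a)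
        = N * ((q - 1) * s * t * b / R - R * a) := by field_simp; ring
    rw [hk]
    split_ifs with hc
    · have h1 : N ^ 2 * (R ^ 2 * a ^ 2 / 2 - (s * b) ^ 2) ≤
          (N * ((q - 1) * s * t * b / R - R * a)) ^ 2 := by
        rw [mul_pow N]
        apply mul_le_mul_of_nonneg_left _ (sq_nonneg N)
        have h2 : ((q - 1) * s * t * b / R) ^ 2 ≤ (s * b) ^ 2 := by
          rw [div_pow, div_le_iff₀ (by positivity)]
          have : (q - 1) ^ 2 * t ^ 2 ≤ 1 * R ^ 2 := by
            apply mul_le_mul _ ht (sq_nonneg _) zero_le_one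
            nlinarith
          nlinarith [mul_le_mul_of_nonneg_right this (sq_nonneg (s * b))]
        nlinarith [sq_nonneg (R * a - 2 * ((q - 1) * s * t * b / R))]
      refine le_trans ?_ (div_le_div_of_nonneg_right h1 (by positivity))
      have hNG : N ≤ G := by
        apply le_of_sq_le_sq _ hG.le
        nlinarith [sq_nonneg (R * s)]
      have hG3 : G ^ 3 ≤ 4 * N ^ 3 := by
        have : G ≤ 2 * N := by
          apply le_of_sq_le_sq _ (by positivity)
          nlinarith [sq_nonneg N]
        calc G ^ 3 = G ^ 2 * G := by ring
          _ ≤ (2 * N ^ 2) * (2 * N) := by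
            apply mul_le_mul _ this hG.le (by positivity)
            linarith
          _ = 4 * N ^ 3 := by ring
      have k1 : R ^ 2 / N * a ^ 2 / 8 ≤ N ^ 2 * (R ^ 2 * a ^ 2 / 2) / G ^ 3 := by
        rw [le_div_iff₀ (by positivity)]
        calc R ^ 2 / N * a ^ 2 / 8 * G ^ 3 ≤ R ^ 2 / N * a ^ 2 / 8 * (4 * N ^ 3) := by gcongr
          _ = _ := by field_simp; ring
      have k2 : N ^ 2 * (s * b) ^ 2 / G ^ 3 ≤ N / R ^ 2 * b ^ 2 := by
        rw [div_le_iff₀ (by positivity)]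
        have hs : R ^ 2 * s ^ 2 ≤ G ^ 2 := by nlinarith [sq_nonneg N]
        calc N ^ 2 * (s * b) ^ 2 = N * N / R ^ 2 * b ^ 2 * (R ^ 2 * s ^ 2) := by field_simp
          _ ≤ N * G / R ^ 2 * b ^ 2 * G ^ 2 := by gcongr
          _ = _ := by ring
      rw [mul_sub, sub_div]; linarith
    · have : 0 ≤ (N * ((q - 1) * s * t * b / R - R * a)) ^ 2 / G ^ 3 := by positivity
      have : 0 ≤ N / R ^ 2 * b ^ 2 := by positivity
      linarith
  linarith

theorem bellman_weight_le {p q s τ ε : ℝ} (hpq : p.HolderConjugate q) (hp : 2 ≤ p) (hε : 0 < ε)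
    (hτ : 0 < τ) (h : τ ^ q < τ * s ^ 2) : τ / τ ^ (q / 2) ≤ (s ^ 2 + ε) ^ (p / 2 - 1) := by
  have h1 : τ ^ (q - 1) ≤ s ^ 2 + ε := by
    rw [Real.rpow_sub_one hτ.ne', div_le_iff₀ hτ]; nlinarith
  have h2 : τ / τ ^ (q / 2) = (τ ^ (q - 1)) ^ (p / 2 - 1) := by
    rw [← Real.rpow_mul hτ.le]
    nth_rewrite 1 [← Real.rpow_one τ]
    rw [← Real.rpow_sub hτ]
    congr 1
    have := hpq.symm.sub_one_mul_conj
    linarith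
  rw [h2]
  exact Real.rpow_le_rpow (by positivity) h1 (by linarith)

theorem bellman_hessian_arith_add {p q R N s t a b A P S G : ℝ} (hp : 2 ≤ p) (hR0 : 0 < R)
    (hN0 : 0 < N) (hq1 : 1 < q) (hq2 : q ≤ 2) (ht : t ^ 2 ≤ R ^ 2) (hA18 : 18 ≤ A)
    (hAq : A * (q - 1) = 18) (hP0 : 0 < P) (hP : N ^ 2 < (R * s) ^ 2 → R ^ 2 / N ≤ P)
    (hS : p * (P * a ^ 2) ≤ S) (hG0 : 0 < G) (hG2 : G ^ 2 = (R * s) ^ 2 + N ^ 2) :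
    (R ^ 2 / N * a ^ 2 + b ^ 2 / (R ^ 2 / N)) / 16 ≤
      A * S + A * (4 * (q / 2) * (q / 2 - 1) * (N / R ^ 4) * (t * b) ^ 2
        + 2 * (q / 2) * (N / R ^ 2) * b ^ 2) +
      ((R * s * ((4 * (1 / 2) * (1 / 2 - 1) * (1 / R ^ 3) * (t * b) ^ 2
        + 2 * (1 / 2) * (1 / R) * b ^ 2) * s + 1 / 2 * (1 / R) * (2 * t * b) * a
        + 1 / 2 * (1 / R) * (2 * t * b) * a) + N * (4 * (q / 2) * (q / 2 - 1) * (N / R ^ 4)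
        * (t * b) ^ 2 + 2 * (q / 2) * (N / R ^ 2) * b ^ 2)) / G
      + (R * s * (q / 2 * (N / R ^ 2) * (2 * t * b))
        - N * (1 / 2 * (1 / R) * (2 * t * b) * s + R * a)) ^ 2 / G ^ 3) := by
  obtain ⟨N₂, hN₂⟩ : ∃ N₂, N₂ = 4 * (q / 2) * (q / 2 - 1) * (N / R ^ 4) * (t * b) ^ 2
      + 2 * (q / 2) * (N / R ^ 2) * b ^ 2 := ⟨_, rfl⟩
  rw [← hN₂]
  have hN₂le : q * (q - 1) * (N / R ^ 2 * b ^ 2) ≤ N₂ := by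
    have : N₂ - q * (q - 1) * (N / R ^ 2 * b ^ 2) =
        q * (2 - q) * (N / R ^ 4) * b ^ 2 * (R ^ 2 - t ^ 2) := by
      rw [hN₂]; field_simp; ring
    have h2 : 0 ≤ q * (2 - q) * (N / R ^ 4) * b ^ 2 * (R ^ 2 - t ^ 2) := by
      have h21 := sub_nonneg.2 hq2
      have h22 := sub_nonneg.2 ht
      positivity
    linarith
  have hNb : 0 ≤ N / R ^ 2 * b ^ 2 := by positivity
  have hN₂0 : 0 ≤ N₂ := le_trans (mul_nonneg (mul_nonneg (by linarith) (by linarith)) hNb) hN₂le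
  have main := bellman_hessian_arith (a := a) (b := b) (s := s) hR0 hN0 hq1 hq2 ht hG0 hG2 hN₂0
  have hT : 18 * (N / R ^ 2 * b ^ 2) ≤ A * N₂ := by
    have h1 : A * (q * (q - 1) * (N / R ^ 2 * b ^ 2)) ≤ A * N₂ := by gcongr
    have h2 : A * (q * (q - 1) * (N / R ^ 2 * b ^ 2)) = 18 * q * (N / R ^ 2 * b ^ 2) := by
      rw [← hAq]; ring
    nlinarith
  have hab : 2 * |a * b| ≤ R ^ 2 / N * a ^ 2 / 16 + 16 * (N / R ^ 2 * b ^ 2) := by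
    have h1 : (R ^ 2 / N * a ^ 2 / 16) * (16 * (N / R ^ 2 * b ^ 2)) = |a * b| ^ 2 := by
      rw [sq_abs]; field_simp
    have h2 : 0 ≤ R ^ 2 / N * a ^ 2 / 16 := by positivity
    apply le_of_sq_le_sq _ (by positivity)
    nlinarith [sq_nonneg (R ^ 2 / N * a ^ 2 / 16 - 16 * (N / R ^ 2 * b ^ 2))]
  have hgoal : (R ^ 2 / N * a ^ 2 + b ^ 2 / (R ^ 2 / N)) / 16 =
      R ^ 2 / N * a ^ 2 / 16 + (N / R ^ 2 * b ^ 2) / 16 := by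
    field_simp
  have hmix : (R * s * ((4 * (1 / 2) * (1 / 2 - 1) * (1 / R ^ 3) * (t * b) ^ 2
        + 2 * (1 / 2) * (1 / R) * b ^ 2) * s + 1 / 2 * (1 / R) * (2 * t * b) * a
        + 1 / 2 * (1 / R) * (2 * t * b) * a) + N * N₂) / G
      + (R * s * (q / 2 * (N / R ^ 2) * (2 * t * b))
        - N * (1 / 2 * (1 / R) * (2 * t * b) * s + R * a)) ^ 2 / G ^ 3 =
      (R * s * ((R ^ 2 - t ^ 2) * b ^ 2 / R ^ 3 * s + 2 * (t * b / R) * a) + N * N₂) / G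
      + (R * s * (q * t * b * N / R ^ 2) - N * (t * b / R * s + R * a)) ^ 2 / G ^ 3 := by
    congr 2
    · field_simp; ring
    · field_simp
  rw [hgoal]
  refine le_trans ?_ (add_le_add (add_le_add (mul_le_mul_of_nonneg_left hS (by linarith)) hT)
    (main.trans_eq hmix.symm))
  have hPa : 0 ≤ P * a ^ 2 := by positivity
  have hAp : 36 * (P * a ^ 2) ≤ A * (p * (P * a ^ 2)) := by
    rw [← mul_assoc A]
    have : 36 ≤ A * p := by nlinarith
    gcongr
  split_ifs with hc
  · linarith
  · have hw : R ^ 2 / N ≤ P := hP (not_le.1 hc)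
    have : R ^ 2 / N * a ^ 2 ≤ P * a ^ 2 := by gcongr
    linarith

theorem exists_weight_le_bellman_hessian {p q ε : ℝ} (hpq : p.HolderConjugate q) (hp : 2 ≤ p)
    (hε : 0 < ε) (z : ℝ × ℝ) :
    ∃ w : ℝ, 0 < w ∧ ∀ a b : ℝ, (w * a ^ 2 + b ^ 2 / w) / 16 ≤
      fderiv ℝ (fderiv ℝ (bellman p q (18 / (q - 1)) ε)) z (a, b) (a, b) := by
  obtain ⟨s, t⟩ := z
  have hq1 : 1 < q := hpq.symm.lt
  have hq2 : q ≤ 2 := by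
    have := hpq.symm.sub_one_mul_conj
    nlinarith
  set τ := t ^ 2 + ε with hτ
  have hτ0 : 0 < τ := by positivity
  set R := τ ^ (1 / 2 : ℝ) with hR
  set N := τ ^ (q / 2) with hN
  have hR0 : 0 < R := by positivity
  have hN0 : 0 < N := by positivity
  have hR2 : R ^ 2 = τ := by
    rw [hR, ← Real.rpow_natCast, ← Real.rpow_mul hτ0.le]; norm_num
  have hN2 : N ^ 2 = τ ^ q := by
    rw [hN, ← Real.rpow_natCast, ← Real.rpow_mul hτ0.le]; norm_num
  have ht : t ^ 2 ≤ R ^ 2 := by rw [hR2]; linarith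
  refine ⟨R ^ 2 / N, by positivity, fun a b => ?_⟩
  set A := 18 / (q - 1) with hA
  have hA18 : 18 ≤ A := by rw [hA, le_div_iff₀ (by linarith)]; linarith
  have hAq : A * (q - 1) = 18 := by rw [hA]; field_simp [show q - 1 ≠ 0 by linarith]
  have hlin : ∀ y : ℝ, HasDerivAt (fun y : ℝ => s + y * a) a y := fun y => by
    simpa using ((hasDerivAt_id y).mul_const a).const_add s
  have hM := fun y => (hasDerivAt_sq_add_rpow hε (1 / 2) t b y).mul (hlin y)
  have hN' := fun y => hasDerivAt_sq_add_rpow hε (q / 2) t b y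
  have hM2 := ((hasDerivAt_deriv_sq_add_rpow hε (1 / 2) t b 0).mul (hlin 0)).add
    ((hasDerivAt_sq_add_rpow hε (1 / 2) t b 0).mul_const a)
  have hN2' := hasDerivAt_deriv_sq_add_rpow hε (q / 2) t b 0
  have hpos : ∀ y : ℝ, 0 < ((t + y * b) ^ 2 + ε) ^ (q / 2) := fun y => by positivity
  have key := fderiv_fderiv_apply_eq_of_line (contDiff_bellman p q A hε) (s, t) (a, b)
    (fun y => (((hasDerivAt_sq_add_rpow hε (p / 2) s a y).const_mul A).add
      ((hasDerivAt_sq_add_rpow hε (q / 2) t b y).const_mul A)).add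
      (hasDerivAt_sqrt_sq_add_sq (hM y) (hN' y) (hpos y)))
    ((((hasDerivAt_deriv_sq_add_rpow hε (p / 2) s a 0).const_mul A).add
      ((hasDerivAt_deriv_sq_add_rpow hε (q / 2) t b 0).const_mul A)).add
      (hasDerivAt_deriv_sqrt_sq_add_sq (hM 0) (hN' 0) hM2 hN2' (hpos 0)))
  rw [key]
  simp only [Pi.mul_apply, Pi.add_apply, zero_smul, zero_mul, add_zero, ← hτ, ← hR, ← hN]
  have r1 : τ ^ ((1 : ℝ) / 2 - 1) = 1 / R := by
    rw [Real.rpow_sub_one hτ0.ne', ← hR, ← hR2]; field_simp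
  have r2 : τ ^ ((1 : ℝ) / 2 - 2) = 1 / R ^ 3 := by
    rw [Real.rpow_sub hτ0, ← hR, Real.rpow_two, ← hR2]; field_simp
  have r3 : τ ^ (q / 2 - 1) = N / R ^ 2 := by
    rw [Real.rpow_sub_one hτ0.ne', ← hN, ← hR2]
  have r4 : τ ^ (q / 2 - 2) = N / R ^ 4 := by
    rw [Real.rpow_sub hτ0, ← hN, Real.rpow_two, ← hR2]; field_simp
  rw [r1, r2, r3, r4]
  set G := √((R * s) ^ 2 + N ^ 2) with hG
  have hG0 : 0 < G := by positivity
  have hG2 : G ^ 2 = (R * s) ^ 2 + N ^ 2 := Real.sq_sqrt (by positivity)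
  have hS : p * ((s ^ 2 + ε) ^ (p / 2 - 1) * a ^ 2) ≤
      4 * (p / 2) * (p / 2 - 1) * (s ^ 2 + ε) ^ (p / 2 - 2) * (s * a) ^ 2 +
      2 * (p / 2) * (s ^ 2 + ε) ^ (p / 2 - 1) * a ^ 2 := by
    have h1 : 0 ≤ p / 2 - 1 := by linarith
    have : 0 ≤ 4 * (p / 2) * (p / 2 - 1) * (s ^ 2 + ε) ^ (p / 2 - 2) * (s * a) ^ 2 := by positivity
    linarith
  refine bellman_hessian_arith_add hp hR0 hN0 hq1 hq2 ht hA18 hAq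
    (by positivity : 0 < (s ^ 2 + ε) ^ (p / 2 - 1)) (fun hc => ?_) hS hG0 hG2
  rw [hR2]
  apply bellman_weight_le hpq hp hε hτ0
  rw [mul_pow, hR2, hN2] at hc
  exact hc

theorem bellman_nonneg {p q A ε : ℝ} (hA : 0 ≤ A) (hε : 0 < ε) (z : ℝ × ℝ) :
    0 ≤ bellman p q A ε z := by
  unfold bellman; positivity

theorem sq_add_rpow_half_le {p ε : ℝ} (hp : 0 < p) (hε : 0 < ε) (s : ℝ) :
    (s ^ 2 + ε) ^ (p / 2) ≤ 2 ^ (p / 2) * (|s| ^ p + ε ^ (p / 2)) := by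
  have h1 : s ^ 2 + ε ≤ 2 * max (s ^ 2) ε := by
    linarith [le_max_left (s ^ 2) ε, le_max_right (s ^ 2) ε]
  have h2 : (s ^ 2) ^ (p / 2) = |s| ^ p := by
    rw [← sq_abs, ← Real.rpow_natCast, ← Real.rpow_mul (abs_nonneg _)]
    congr 1; push_cast; ring
  calc (s ^ 2 + ε) ^ (p / 2) ≤ (2 * max (s ^ 2) ε) ^ (p / 2) :=
        Real.rpow_le_rpow (by positivity) h1 (by positivity)
    _ = 2 ^ (p / 2) * (max (s ^ 2) ε) ^ (p / 2) := Real.mul_rpow (by norm_num) (by positivity)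
    _ ≤ _ := by
      gcongr
      rw [← h2]
      rcases max_cases (s ^ 2) ε with h | h <;> rw [h.1]
      · linarith [show 0 ≤ ε ^ (p / 2) by positivity]
      · linarith [show 0 ≤ (s ^ 2) ^ (p / 2) by positivity]

theorem exists_bellman_le {p q A : ℝ} (hpq : p.HolderConjugate q) (hA : 0 ≤ A) :
    ∃ C : ℝ, 0 < C ∧ ∀ ε : ℝ, 0 < ε → ∀ z : ℝ × ℝ,
      bellman p q A ε z ≤ C * (|z.1| ^ p + |z.2| ^ q + (ε ^ (p / 2) + ε ^ (q / 2))) := by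
  have hp := hpq.pos
  have hq := hpq.symm.pos
  refine ⟨(A + 2) * (2 ^ (p / 2) + 2 ^ (q / 2)), by positivity, fun ε hε z => ?_⟩
  obtain ⟨s, t⟩ := z
  set σ := s ^ 2 + ε with hσ
  set τ := t ^ 2 + ε with hτ
  have hσ0 : 0 < σ := by positivity
  have hτ0 : 0 < τ := by positivity
  have hs : |s| ≤ σ ^ (1 / 2 : ℝ) := by
    rw [← Real.sqrt_eq_rpow]; apply Real.abs_le_sqrt; linarith
  have h1 : √((τ ^ (1 / 2 : ℝ) * s) ^ 2 + (τ ^ (q / 2)) ^ 2) ≤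
      τ ^ (1 / 2 : ℝ) * |s| + τ ^ (q / 2) := by
    rw [Real.sqrt_le_left (by positivity)]
    have : 0 ≤ τ ^ (1 / 2 : ℝ) * |s| * τ ^ (q / 2) := by positivity
    rw [mul_pow, ← sq_abs s]; nlinarith
  have h2 : τ ^ (1 / 2 : ℝ) * |s| ≤ σ ^ (p / 2) + τ ^ (q / 2) := by
    calc τ ^ (1 / 2 : ℝ) * |s| ≤ τ ^ (1 / 2 : ℝ) * σ ^ (1 / 2 : ℝ) := by gcongr
      _ = σ ^ (1 / 2 : ℝ) * τ ^ (1 / 2 : ℝ) := mul_comm _ _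
      _ ≤ (σ ^ (1 / 2 : ℝ)) ^ p / p + (τ ^ (1 / 2 : ℝ)) ^ q / q :=
        Real.young_inequality_of_nonneg (by positivity) (by positivity) hpq
      _ ≤ (σ ^ (1 / 2 : ℝ)) ^ p + (τ ^ (1 / 2 : ℝ)) ^ q :=
        add_le_add (div_le_self (by positivity) hpq.lt.le)
          (div_le_self (by positivity) hpq.symm.lt.le)
      _ = _ := by
        rw [← Real.rpow_mul hσ0.le, ← Real.rpow_mul hτ0.le]
        congr 2 <;> ring
  have h3 := sq_add_rpow_half_le hp hε s
  have h4 := sq_add_rpow_half_le hq hε t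
  rw [← hσ] at h3
  rw [← hτ] at h4
  have h5 : bellman p q A ε (s, t) ≤ (A + 2) * (σ ^ (p / 2) + τ ^ (q / 2)) := by
    have : 0 < σ ^ (p / 2) := by positivity
    unfold bellman
    simp only [← hσ, ← hτ]
    linarith
  refine h5.trans ?_
  rw [mul_assoc]
  gcongr
  have a1 : 0 ≤ 2 ^ (p / 2) * (|t| ^ q + ε ^ (q / 2)) := by positivity
  have a2 : 0 ≤ 2 ^ (q / 2) * (|s| ^ p + ε ^ (p / 2)) := by positivity
  nlinarith

/-- The closed cube `[-1, 1]ⁿ`, a fundamental cell of the lattice `(2ℤ)ⁿ`. -/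
def cube (n : ℕ) : Set (EuclideanSpace ℝ (Fin n)) :=
  WithLp.ofLp ⁻¹' Set.univ.pi fun _ => Set.Icc (-1) 1

theorem mem_cube {n : ℕ} {x : EuclideanSpace ℝ (Fin n)} :
    x ∈ cube n ↔ ∀ i, x i ∈ Set.Icc (-1 : ℝ) 1 := by
  simp only [cube, Set.mem_preimage, Set.mem_univ_pi]

theorem isCompact_cube (n : ℕ) : IsCompact (cube n) := by
  have : cube n = (WithLp.toLp 2) '' (Set.univ.pi fun _ : Fin n => Set.Icc (-1 : ℝ) 1) := by
    ext x
    simp only [cube, Set.mem_preimage, Set.mem_image]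
    exact ⟨fun h => ⟨x.ofLp, h, rfl⟩, by rintro ⟨y, hy, rfl⟩; exact hy⟩
  rw [this]
  exact (isCompact_univ_pi fun _ => isCompact_Icc).image (by fun_prop)

theorem measurableSet_cube (n : ℕ) : MeasurableSet (cube n) :=
  (isCompact_cube n).isClosed.measurableSet

theorem Continuous.integrableOn_cube {n : ℕ} {F : EuclideanSpace ℝ (Fin n) → ℝ}
    (hF : Continuous F) : IntegrableOn F (cube n) :=
  hF.continuousOn.integrableOn_compact (isCompact_cube n)

theorem setIntegral_cube_eq_prod {m : ℕ} (i : Fin (m + 1))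
    (F : EuclideanSpace ℝ (Fin (m + 1)) → ℝ) :
    ∫ x in cube (m + 1), F x =
      ∫ z in (Set.Icc (-1 : ℝ) 1) ×ˢ (Set.univ.pi fun _ : Fin m => Set.Icc (-1 : ℝ) 1),
        F (WithLp.toLp 2 (i.insertNth z.1 z.2)) := by
  have h1 := (PiLp.volume_preserving_ofLp (Fin (m + 1))).setIntegral_preimage_emb
    (MeasurableEquiv.toLp 2 (Fin (m + 1) → ℝ)).symm.measurableEmbedding
    (fun y => F (WithLp.toLp 2 y)) (Set.univ.pi fun _ => Set.Icc (-1) 1)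
  have h2 := (volume_preserving_piFinSuccAbove (fun _ : Fin (m + 1) => ℝ) i).setIntegral_preimage_emb
    (MeasurableEquiv.piFinSuccAbove _ i).measurableEmbedding
    (fun z => F (WithLp.toLp 2 (i.insertNth z.1 z.2)))
    ((Set.Icc (-1 : ℝ) 1) ×ˢ (Set.univ.pi fun _ : Fin m => Set.Icc (-1 : ℝ) 1))
  rw [show ∫ x in cube (m + 1), F x = _ from h1, Measure.volume_eq_prod] at *
  rw [← h2]
  have hset : (Set.univ.pi fun _ : Fin (m + 1) => Set.Icc (-1 : ℝ) 1) =
      (MeasurableEquiv.piFinSuccAbove (fun _ => ℝ) i) ⁻¹'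
        ((Set.Icc (-1 : ℝ) 1) ×ˢ (Set.univ.pi fun _ : Fin m => Set.Icc (-1 : ℝ) 1)) := by
    ext y
    simp only [Set.mem_preimage, Set.mem_prod, Set.mem_univ_pi]
    exact Fin.forall_iff_succAbove i
  rw [hset]
  congr 1
  funext y
  congr 2
  exact (Fin.insertNth_self_removeNth i y).symm

theorem setIntegral_cube_mono_of_slices {n : ℕ} (i : Fin n) {F G : EuclideanSpace ℝ (Fin n) → ℝ}
    (hF : Continuous F) (hG : Continuous G)
    (h : ∀ x : EuclideanSpace ℝ (Fin n),
      ∫ s in (-1 : ℝ)..1, F (x + s • EuclideanSpace.single i 1) ≤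
        ∫ s in (-1 : ℝ)..1, G (x + s • EuclideanSpace.single i 1)) :
    ∫ x in cube n, F x ≤ ∫ x in cube n, G x := by
  obtain _ | m := n
  · exact i.elim0
  rw [setIntegral_cube_eq_prod i, setIntegral_cube_eq_prod i, Measure.volume_eq_prod,
    ← Measure.prod_restrict]
  have hc : Continuous fun z : ℝ × (Fin m → ℝ) =>
      WithLp.toLp 2 (i.insertNth z.1 z.2 : Fin (m + 1) → ℝ) := by
    apply (PiLp.continuous_toLp 2 _).comp
    exact Continuous.finInsertNth (A := fun _ => ℝ) i continuous_fst continuous_snd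
  have hint : ∀ H : EuclideanSpace ℝ (Fin (m + 1)) → ℝ, Continuous H →
      Integrable (fun z : ℝ × (Fin m → ℝ) => H (WithLp.toLp 2 (i.insertNth z.1 z.2)))
        ((volume.restrict (Set.Icc (-1 : ℝ) 1)).prod
          (volume.restrict (Set.univ.pi fun _ : Fin m => Set.Icc (-1 : ℝ) 1))) := fun H hH => by
    rw [Measure.prod_restrict]
    exact (hH.comp hc).continuousOn.integrableOn_compact
      (isCompact_Icc.prod (isCompact_univ_pi fun _ => isCompact_Icc))
  rw [integral_prod_symm _ (hint F hF), integral_prod_symm _ (hint G hG)]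
  refine integral_mono (hint F hF).integral_prod_right (hint G hG).integral_prod_right fun y => ?_
  have := h (WithLp.toLp 2 (i.insertNth 0 y))
  rw [intervalIntegral.integral_of_le (by norm_num), intervalIntegral.integral_of_le (by norm_num),
    ← integral_Icc_eq_integral_Ioc, ← integral_Icc_eq_integral_Ioc] at this
  have hx : ∀ s : ℝ,
      (WithLp.toLp 2 (i.insertNth s y : Fin (m + 1) → ℝ) : EuclideanSpace ℝ (Fin (m + 1))) =
      WithLp.toLp 2 (i.insertNth 0 y) + s • EuclideanSpace.single i 1 := fun s => by
    ext j
    refine Fin.succAboveCases i ?_ (fun k => ?_) j <;> simp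
  simpa only [← hx] using this

theorem setIntegral_cube_deriv_eq_zero {n : ℕ} (i : Fin n) {H H' : EuclideanSpace ℝ (Fin n) → ℝ}
    (hH' : Continuous H')
    (hd : ∀ (x : EuclideanSpace ℝ (Fin n)) (s : ℝ), HasDerivAt
      (fun s : ℝ => H (x + s • EuclideanSpace.single i 1))
        (H' (x + s • EuclideanSpace.single i 1)) s)
    (hper : ∀ x, H (x + (2 : ℝ) • EuclideanSpace.single i 1) = H x) :
    ∫ x in cube n, H' x = 0 := by
  have hsl : ∀ x, ∫ s in (-1 : ℝ)..1, H' (x + s • EuclideanSpace.single i 1) = 0 := fun x => by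
    rw [intervalIntegral.integral_eq_sub_of_hasDerivAt (fun s _ => hd x s)
      ((hH'.comp (by fun_prop)).intervalIntegrable _ _), sub_eq_zero,
      ← hper (x + (-1 : ℝ) • EuclideanSpace.single i 1), add_assoc, ← add_smul]
    norm_num
  apply le_antisymm
  · simpa using setIntegral_cube_mono_of_slices i hH' (continuous_const (y := (0 : ℝ)))
      (fun x => by simp [hsl])
  · simpa using setIntegral_cube_mono_of_slices i (continuous_const (y := (0 : ℝ))) hH'
      (fun x => by simp [hsl])

theorem intervalIntegral_abs_rpow_le_deriv {q : ℝ} (hq : 1 ≤ q) {G h h' : ℝ → ℝ}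
    (hG : ∀ s, HasDerivAt G (h s) s) (hh : ∀ s, HasDerivAt h (h' s) s) (hh' : Continuous h')
    (hper : G (-1) = G 1) :
    ∫ s in (-1 : ℝ)..1, |h s| ^ q ≤ 2 ^ q * ∫ s in (-1 : ℝ)..1, |h' s| ^ q := by
  have hq0 : 0 < q := by linarith
  obtain ⟨c, hc, hc0⟩ := exists_hasDerivAt_eq_zero (f := G) (f' := h) (by norm_num : (-1 : ℝ) < 1)
    (fun s _ => (hG s).continuousAt.continuousWithinAt) hper (fun s _ => hG s)
  have hhc : Continuous h := continuous_iff_continuousAt.2 fun s => (hh s).continuousAt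
  have hI : ∀ a b, IntervalIntegrable (fun s => |h' s|) volume a b :=
    fun a b => hh'.abs.intervalIntegrable a b
  set J := ∫ s in (-1 : ℝ)..1, |h' s| with hJ
  have hbd : ∀ s ∈ Set.Icc (-1 : ℝ) 1, |h s| ≤ J := fun s hs => by
    have h1 : ∫ r in c..s, h' r = h s := by
      rw [intervalIntegral.integral_eq_sub_of_hasDerivAt (fun r _ => hh r)
        (hh'.intervalIntegrable _ _), hc0, sub_zero]
    rw [← h1]
    refine (intervalIntegral.norm_integral_le_abs_integral_norm (f := h')).trans ?_
    simp only [Real.norm_eq_abs]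
    rw [hJ, ← abs_of_nonneg (intervalIntegral.integral_nonneg (by norm_num)
      (fun u _ => abs_nonneg (h' u)) : 0 ≤ ∫ s in (-1 : ℝ)..1, |h' s|)]
    apply intervalIntegral.abs_integral_mono_interval _ _ (hI _ _)
    · intro r hr
      rw [Set.uIoc_of_le (by norm_num)]
      exact ⟨lt_of_le_of_lt (le_min hc.1.le hs.1) hr.1, hr.2.trans (max_le hc.2.le hs.2)⟩
    · exact Filter.Eventually.of_forall fun _ => abs_nonneg _
  have hJ0 : 0 ≤ J := intervalIntegral.integral_nonneg (by norm_num) (fun u _ => abs_nonneg (h' u))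
  have hcq : Continuous fun s => |h' s| ^ q :=
    hh'.abs.rpow_const fun _ => Or.inr hq0.le
  have hcq2 : Continuous fun s => |h s| ^ q :=
    hhc.abs.rpow_const fun _ => Or.inr hq0.le
  have h1 : ∫ s in (-1 : ℝ)..1, |h s| ^ q ≤ 2 * J ^ q := by
    calc ∫ s in (-1 : ℝ)..1, |h s| ^ q ≤ ∫ s in (-1 : ℝ)..1, J ^ q := by
          apply intervalIntegral.integral_mono_on (by norm_num) (hcq2.intervalIntegrable _ _) (by simp)
          intro s hs
          exact Real.rpow_le_rpow (abs_nonneg _) (hbd s hs) hq0.le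
      _ = 2 * J ^ q := by rw [intervalIntegral.integral_const, smul_eq_mul]; norm_num
  have h2 : (J / 2) ^ q ≤ (∫ s in (-1 : ℝ)..1, |h' s| ^ q) / 2 := by
    have := (convexOn_rpow hq).map_set_average_le (μ := volume) (t := Set.Ioc (-1 : ℝ) 1)
      (f := fun s => |h' s|) (continuousOn_id.rpow_const fun _ _ => Or.inr hq0.le) isClosed_Ici
      (by simp) (by simp) (Filter.Eventually.of_forall fun s => abs_nonneg (h' s))
      ((intervalIntegrable_iff_integrableOn_Ioc_of_le (by norm_num)).1 (hI _ _))
      ((intervalIntegrable_iff_integrableOn_Ioc_of_le (by norm_num)).1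
        (hcq.intervalIntegrable (-1) 1))
    rw [setAverage_eq, setAverage_eq, ← intervalIntegral.integral_of_le (by norm_num),
      ← intervalIntegral.integral_of_le (by norm_num)] at this
    norm_num at this
    convert this using 1
    · rw [hJ]; congr 1; ring
    · ring
  rw [Real.div_rpow hJ0 (by norm_num), div_le_iff₀ (by positivity)] at h2
  linarith

theorem hasDerivAt_setIntegral_of_continuous {E : Type*} [NormedAddCommGroup E] [MeasurableSpace E]
    [BorelSpace E] {μ : Measure E} [IsFiniteMeasureOnCompacts μ] {K : Set E} (hK : IsCompact K)
    {G G' : ℝ → E → ℝ} (hG : ∀ t, Continuous (G t)) (hG' : Continuous fun z : ℝ × E => G' z.1 z.2)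
    (hd : ∀ t x, HasDerivAt (fun t => G t x) (G' t x) t) (t : ℝ) :
    HasDerivAt (fun t => ∫ x in K, G t x ∂μ) (∫ x in K, G' t x ∂μ) t := by
  obtain ⟨C, hC⟩ := ((isCompact_closedBall t 1).prod hK).exists_bound_of_continuousOn hG'.continuousOn
  have hGm : ∀ t, IntegrableOn (G t) K μ := fun t =>
    (hG t).continuousOn.integrableOn_compact hK
  refine (hasDerivAt_integral_of_dominated_loc_of_deriv_le (μ := μ.restrict K)
    (F := G) (F' := G') (bound := fun _ => C) (closedBall_mem_nhds t one_pos)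
    (Filter.Eventually.of_forall fun s => (hGm s).aestronglyMeasurable) (hGm t)
    ((hG'.comp (by fun_prop : Continuous fun x : E => (t, x))).continuousOn.integrableOn_compact
      hK).aestronglyMeasurable ?_ ?_ ?_).2
  · refine (ae_restrict_mem hK.isClosed.measurableSet).mono fun x hx s hs => ?_
    exact hC (s, x) ⟨hs, hx⟩
  · exact integrableOn_const hK.measure_lt_top.ne
  · exact Filter.Eventually.of_forall fun x s _ => hd s x

theorem hasDerivAt_line_partialDeriv' {n : ℕ} {u : EuclideanSpace ℝ (Fin n) → ℝ}
    (hu : Differentiable ℝ u) (i : Fin n) (x : EuclideanSpace ℝ (Fin n)) (s : ℝ) :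
    HasDerivAt (fun s : ℝ => u (x + s • EuclideanSpace.single i 1))
      (partialDeriv' i u (x + s • EuclideanSpace.single i 1)) s := by
  have hline : HasDerivAt (fun s : ℝ => x + s • EuclideanSpace.single i (1 : ℝ))
      (EuclideanSpace.single i 1) s := by
    simpa using ((hasDerivAt_id s).smul_const (EuclideanSpace.single i (1 : ℝ))).const_add x
  exact (hu _).hasFDerivAt.comp_hasDerivAt s hline

theorem partialDeriv'_eq_of_hasDerivAt {n : ℕ} {u : EuclideanSpace ℝ (Fin n) → ℝ}
    (hu : Differentiable ℝ u) {i : Fin n} {x : EuclideanSpace ℝ (Fin n)} {d : ℝ}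
    (h : HasDerivAt (fun s : ℝ => u (x + s • EuclideanSpace.single i 1)) d 0) :
    partialDeriv' i u x = d := by
  have := (hasDerivAt_line_partialDeriv' hu i x 0).unique h
  simpa using this

/-- A list of triples `(k, c, a)` encodes the trigonometric polynomial `∑ c cos (π k·x + a)`. -/
abbrev TrigData (n : ℕ) := List ((Fin n → ℤ) × ℝ × ℝ)

namespace TrigData

variable {n : ℕ}

/-- The function encoded by a single triple. -/
noncomputable def term (m : (Fin n → ℤ) × ℝ × ℝ) (x : EuclideanSpace ℝ (Fin n)) : ℝ :=
  m.2.1 * Real.cos (Real.pi * ∑ i, (m.1 i : ℝ) * x i + m.2.2)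

/-- The trigonometric polynomial encoded by a list. -/
noncomputable def eval (L : TrigData n) (x : EuclideanSpace ℝ (Fin n)) : ℝ :=
  (L.map fun m => term m x).sum

/-- Fourier multiplier with symbol `φ`. -/
noncomputable def scale (φ : (Fin n → ℤ) → ℝ) (L : TrigData n) : TrigData n :=
  L.map fun m => (m.1, φ m.1 * m.2.1, m.2.2)

/-- Partial derivative in the `i`-th direction. -/
noncomputable def diff (i : Fin n) (L : TrigData n) : TrigData n :=
  L.map fun m => (m.1, Real.pi * m.1 i * m.2.1, m.2.2 + Real.pi / 2)

/-- The eigenvalue of `-Δ` at frequency `k`. -/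
noncomputable def freq (k : Fin n → ℤ) : ℝ := ∑ i, (Real.pi * k i) ^ 2

/-- Heat flow at time `t`. -/
noncomputable def heat (t : ℝ) (L : TrigData n) : TrigData n :=
  scale (fun k => Real.exp (-(freq k * t))) L

@[simp] theorem eval_nil (x : EuclideanSpace ℝ (Fin n)) : eval [] x = 0 := rfl

@[simp] theorem eval_cons (m : (Fin n → ℤ) × ℝ × ℝ) (L : TrigData n)
    (x : EuclideanSpace ℝ (Fin n)) : eval (m :: L) x = term m x + eval L x := by
  simp [eval]

theorem eval_append (L L' : TrigData n) (x : EuclideanSpace ℝ (Fin n)) :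
    eval (L ++ L') x = eval L x + eval L' x := by
  simp [eval]

theorem eval_scale_add (φ ψ : (Fin n → ℤ) → ℝ) (L : TrigData n) (x : EuclideanSpace ℝ (Fin n)) :
    eval (scale (fun k => φ k + ψ k) L) x = eval (scale φ L) x + eval (scale ψ L) x := by
  induction L with
  | nil => simp [scale]
  | cons m L ih =>
    simp only [scale, List.map_cons, eval_cons, term] at ih ⊢
    rw [ih]; ring

theorem scale_scale (φ ψ : (Fin n → ℤ) → ℝ) (L : TrigData n) :
    scale φ (scale ψ L) = scale (fun k => φ k * ψ k) L := by
  simp [scale, mul_assoc]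

theorem scale_one (L : TrigData n) : scale (fun _ => 1) L = L := by
  simp [scale]

theorem diff_scale (i : Fin n) (φ : (Fin n → ℤ) → ℝ) (L : TrigData n) :
    diff i (scale φ L) = scale φ (diff i L) := by
  simp [scale, diff, mul_left_comm]

theorem diff_heat (i : Fin n) (t : ℝ) (L : TrigData n) :
    diff i (heat t L) = heat t (diff i L) := diff_scale _ _ _

theorem heat_zero (L : TrigData n) : heat 0 L = L := by
  simp [heat, scale_one]

theorem contDiff_eval (L : TrigData n) : ContDiff ℝ (⊤ : ℕ∞) (eval L) := by
  induction L with
  | nil => exact contDiff_const (c := (0 : ℝ))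
  | cons m L ih =>
    have : eval (m :: L) = fun x => term m x + eval L x := funext fun x => eval_cons m L x
    rw [this]
    refine ContDiff.add ?_ ih
    unfold term
    fun_prop

theorem continuous_eval (L : TrigData n) : Continuous (eval L) := (contDiff_eval L).continuous

theorem differentiable_eval (L : TrigData n) : Differentiable ℝ (eval L) :=
  (contDiff_eval L).differentiable (by simp)

theorem sum_mul_line (k : Fin n → ℤ) (i : Fin n) (x : EuclideanSpace ℝ (Fin n)) (s : ℝ) :
    ∑ j, (k j : ℝ) * (x + s • EuclideanSpace.single i (1 : ℝ)) j =
      ∑ j, (k j : ℝ) * x j + k i * s := by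
  simp [mul_add, Finset.sum_add_distrib]

theorem hasDerivAt_line_eval (i : Fin n) (L : TrigData n) (x : EuclideanSpace ℝ (Fin n)) :
    HasDerivAt (fun s : ℝ => eval L (x + s • EuclideanSpace.single i 1)) (eval (diff i L) x) 0 := by
  induction L with
  | nil => simpa [diff] using hasDerivAt_const (0 : ℝ) (0 : ℝ)
  | cons m L ih =>
    simp only [diff, List.map_cons, eval_cons] at ih ⊢
    refine HasDerivAt.add ?_ ih
    simp only [term, sum_mul_line]
    have h1 : HasDerivAt (fun s : ℝ => Real.pi * (∑ j, (m.1 j : ℝ) * x j + m.1 i * s) + m.2.2)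
        (Real.pi * m.1 i) 0 := by
      simpa using ((((hasDerivAt_id (0 : ℝ)).const_mul (m.1 i : ℝ)).const_add
        (∑ j, (m.1 j : ℝ) * x j)).const_mul Real.pi).add_const m.2.2
    refine (h1.cos.const_mul m.2.1).congr_deriv ?_
    rw [← add_assoc, Real.cos_add_pi_div_two]
    simp; ring

theorem partialDeriv'_eval (i : Fin n) (L : TrigData n) :
    partialDeriv' i (eval L) = eval (diff i L) :=
  funext fun x => partialDeriv'_eq_of_hasDerivAt (differentiable_eval L) (hasDerivAt_line_eval i L x)

theorem eval_periodic (k : Fin n → ℤ) (L : TrigData n) {x y : EuclideanSpace ℝ (Fin n)}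
    (h : ∀ i, x i = y i + 2 * k i) : eval L x = eval L y := by
  induction L with
  | nil => simp
  | cons m L ih =>
    rw [eval_cons, eval_cons, ih]
    congr 1
    unfold term
    have : Real.pi * ∑ i, (m.1 i : ℝ) * x i + m.2.2 = (Real.pi * ∑ i, (m.1 i : ℝ) * y i + m.2.2)
        + (∑ i, m.1 i * k i : ℤ) * (2 * Real.pi) := by
      simp only [h, mul_add, Finset.sum_add_distrib]
      push_cast
      rw [Finset.sum_mul, Finset.mul_sum, Finset.mul_sum]
      have : ∀ i, Real.pi * ((m.1 i : ℝ) * (2 * k i)) = (m.1 i : ℝ) * k i * (2 * Real.pi) :=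
        fun i => by ring
      simp only [this]
      ring
    rw [this, Real.cos_add_int_mul_two_pi]

theorem eval_add_two_smul (i : Fin n) (L : TrigData n) (x : EuclideanSpace ℝ (Fin n)) :
    eval L (x + (2 : ℝ) • EuclideanSpace.single i 1) = eval L x := by
  refine eval_periodic (fun j => if j = i then 1 else 0) L fun j => ?_
  by_cases h : j = i <;> simp [h]

theorem eval_lap (L : TrigData n) (x : EuclideanSpace ℝ (Fin n)) :
    eval (scale (fun k => -freq k) L) x = ∑ i, eval (diff i (diff i L)) x := by
  induction L with
  | nil => simp [scale, diff]
  | cons m L ih =>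
    simp only [scale, diff, List.map_cons, eval_cons, Finset.sum_add_distrib] at ih ⊢
    rw [ih]
    congr 1
    simp only [term, freq]
    have : ∀ θ : ℝ, Real.cos (θ + (m.2.2 + Real.pi / 2 + Real.pi / 2)) = -Real.cos (θ + m.2.2) :=
      fun θ => by rw [← Real.cos_add_pi]; congr 1; ring
    simp only [this, ← Finset.sum_mul, ← Finset.sum_neg_distrib]
    rw [Finset.sum_mul, Finset.sum_mul, Finset.sum_mul]
    exact Finset.sum_congr rfl fun i _ => by ring

theorem contDiff_heat (L : TrigData n) :
    ContDiff ℝ (⊤ : ℕ∞) fun z : ℝ × EuclideanSpace ℝ (Fin n) => eval (heat z.1 L) z.2 := by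
  induction L with
  | nil => exact contDiff_const (c := (0 : ℝ))
  | cons m L ih =>
    simp only [heat, scale, List.map_cons, eval_cons] at ih ⊢
    refine ContDiff.add ?_ ih
    unfold term
    dsimp only
    fun_prop

theorem hasDerivAt_heat (L : TrigData n) (x : EuclideanSpace ℝ (Fin n)) (t : ℝ) :
    HasDerivAt (fun t => eval (heat t L) x) (∑ i, eval (heat t (diff i (diff i L))) x) t := by
  simp only [← diff_heat]
  rw [← eval_lap]
  induction L with
  | nil => simpa [heat, scale] using hasDerivAt_const t (0 : ℝ)
  | cons m L ih =>
    simp only [heat, scale, List.map_cons, eval_cons] at ih ⊢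
    refine HasDerivAt.add ?_ ih
    simp only [term]
    have h1 : HasDerivAt (fun t : ℝ => -(freq m.1 * t)) (-freq m.1) t := by
      exact ((hasDerivAt_id t).const_mul (freq m.1)).neg.congr_deriv (by simp)
    refine ((h1.exp.mul_const m.2.1).mul_const _).congr_deriv ?_
    ring

theorem freq_nonneg (k : Fin n → ℤ) : 0 ≤ freq k := Finset.sum_nonneg fun _ _ => sq_nonneg _

theorem exists_abs_heat_le (L : TrigData n) :
    ∃ C : ℝ, ∀ t : ℝ, 0 ≤ t → ∀ x, |eval (heat t L) x| ≤ C := by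
  induction L with
  | nil => exact ⟨0, fun t _ x => by simp [heat, scale]⟩
  | cons m L ih =>
    obtain ⟨C, hC⟩ := ih
    refine ⟨|m.2.1| + C, fun t ht x => ?_⟩
    have := hC t ht x
    simp only [heat, scale, List.map_cons, eval_cons] at this ⊢
    refine (abs_add_le _ _).trans (add_le_add ?_ this)
    simp only [term, abs_mul, Real.abs_exp]
    have h1 : Real.exp (-(freq m.1 * t)) ≤ 1 :=
      Real.exp_le_one_iff.2 (neg_nonpos.2 (mul_nonneg (freq_nonneg _) ht))
    calc _ ≤ 1 * |m.2.1| * 1 := by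
          gcongr
          exact Real.abs_cos_le_one _
      _ = _ := by ring

open Filter Topology in
theorem tendsto_heat_diff (i : Fin n) (L : TrigData n) (x : EuclideanSpace ℝ (Fin n)) :
    Tendsto (fun t => eval (heat t (diff i L)) x) atTop (𝓝 0) := by
  induction L with
  | nil => simp [heat, scale, diff]
  | cons m L ih =>
    simp only [heat, scale, diff, List.map_cons, eval_cons] at ih ⊢
    rw [← add_zero (0 : ℝ)]
    refine Tendsto.add ?_ ih
    simp only [term]
    by_cases hk : m.1 i = 0
    · simp [hk]
    · have hf : 0 < freq m.1 := by
        refine Finset.sum_pos' (fun _ _ => sq_nonneg _) ⟨i, Finset.mem_univ _, ?_⟩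
        have : (m.1 i : ℝ) ≠ 0 := by exact_mod_cast hk
        have := Real.pi_ne_zero
        positivity
      have h1 : Tendsto (fun t : ℝ => Real.exp (-(freq m.1 * t))) atTop (𝓝 0) :=
        Real.tendsto_exp_neg_atTop_nhds_zero.comp (tendsto_id.const_mul_atTop hf)
      simpa using (h1.mul_const _).mul_const _

theorem hasDerivAt_eval_line (i : Fin n) (L : TrigData n) (x : EuclideanSpace ℝ (Fin n)) (s : ℝ) :
    HasDerivAt (fun s : ℝ => eval L (x + s • EuclideanSpace.single i 1))
      (eval (diff i L) (x + s • EuclideanSpace.single i 1)) s := by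
  rw [← partialDeriv'_eval]
  exact hasDerivAt_line_partialDeriv' (differentiable_eval L) i x s

theorem integrableOn_eval_mul (L M : TrigData n) :
    IntegrableOn (fun x => eval L x * eval M x) (cube n) :=
  ((continuous_eval L).mul (continuous_eval M)).integrableOn_cube

theorem integrableOn_abs_eval_rpow {r : ℝ} (hr : 0 < r) (L : TrigData n) :
    IntegrableOn (fun x => |eval L x| ^ r) (cube n) :=
  ((continuous_eval L).abs.rpow_const fun _ => Or.inr hr.le).integrableOn_cube

theorem integral_diff_mul (i : Fin n) (L M : TrigData n) :
    ∫ x in cube n, eval (diff i L) x * eval M x =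
      -∫ x in cube n, eval L x * eval (diff i M) x := by
  have h := setIntegral_cube_deriv_eq_zero i (H := fun x => eval L x * eval M x)
    (H' := fun x => eval (diff i L) x * eval M x + eval L x * eval (diff i M) x)
    (((continuous_eval _).mul (continuous_eval _)).add ((continuous_eval _).mul (continuous_eval _)))
    (fun x s => (hasDerivAt_eval_line i L x s).mul (hasDerivAt_eval_line i M x s))
    (fun x => by simp only [eval_add_two_smul])
  rw [integral_add (integrableOn_eval_mul _ _) (integrableOn_eval_mul _ _)] at h
  linarith

theorem integral_fderiv_lap {B : ℝ × ℝ → ℝ} (hB : ContDiff ℝ 2 B) (L M : TrigData n) :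
    ∫ x in cube n, fderiv ℝ B (eval L x, eval M x)
        (∑ i, eval (diff i (diff i L)) x, ∑ i, eval (diff i (diff i M)) x) =
      -∫ x in cube n, ∑ i, fderiv ℝ (fderiv ℝ B) (eval L x, eval M x)
        (eval (diff i L) x, eval (diff i M) x) (eval (diff i L) x, eval (diff i M) x) := by
  have hB1 : ContDiff ℝ 1 (fderiv ℝ B) := hB.fderiv_right (by norm_num)
  have hc1 : Continuous (fderiv ℝ B) := hB1.continuous
  have hc2 : Continuous (fderiv ℝ (fderiv ℝ B)) := (hB1.continuous_fderiv one_ne_zero)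
  have hpair : ∀ L M : TrigData n, Continuous fun x => (eval L x, eval M x) := fun L M =>
    (continuous_eval L).prodMk (continuous_eval M)
  have hc3 : ∀ i, Continuous fun x => fderiv ℝ B (eval L x, eval M x)
      (eval (diff i (diff i L)) x, eval (diff i (diff i M)) x) := fun i =>
    (hc1.comp (hpair L M)).clm_apply (hpair _ _)
  have hc4 : ∀ i, Continuous fun x => fderiv ℝ (fderiv ℝ B) (eval L x, eval M x)
        (eval (diff i L) x, eval (diff i M) x) (eval (diff i L) x, eval (diff i M) x) := fun i =>
    ((hc2.comp (hpair L M)).clm_apply (hpair _ _)).clm_apply (hpair _ _)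
  have key : ∀ i : Fin n, ∫ x in cube n, fderiv ℝ B (eval L x, eval M x)
      (eval (diff i (diff i L)) x, eval (diff i (diff i M)) x) =
      -∫ x in cube n, fderiv ℝ (fderiv ℝ B) (eval L x, eval M x)
        (eval (diff i L) x, eval (diff i M) x) (eval (diff i L) x, eval (diff i M) x) := fun i => by
    have h := setIntegral_cube_deriv_eq_zero i
      (H := fun x => fderiv ℝ B (eval L x, eval M x) (eval (diff i L) x, eval (diff i M) x))
      ((hc4 i).add (hc3 i))
      (fun x s => by
        have h1 := (hasDerivAt_eval_line i L x s).prodMk (hasDerivAt_eval_line i M x s)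
        have h2 := (hasDerivAt_eval_line i (diff i L) x s).prodMk
          (hasDerivAt_eval_line i (diff i M) x s)
        have h3 := ((hB1.differentiable one_ne_zero _).hasFDerivAt.comp_hasDerivAt s h1)
        exact h3.clm_apply h2)
      (fun x => by simp only [eval_add_two_smul])
    simp only [Pi.add_apply] at h
    rw [integral_add (hc4 i).integrableOn_cube (hc3 i).integrableOn_cube] at h
    linarith
  have hs : ∀ x, fderiv ℝ B (eval L x, eval M x)
      (∑ i, eval (diff i (diff i L)) x, ∑ i, eval (diff i (diff i M)) x) =
      ∑ i, fderiv ℝ B (eval L x, eval M x)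
        (eval (diff i (diff i L)) x, eval (diff i (diff i M)) x) := fun x => by
    rw [← map_sum]
    congr 1
    ext <;> simp [Prod.fst_sum, Prod.snd_sum]
  simp only [hs]
  rw [integral_finsetSum _ fun i _ => (hc3 i).integrableOn_cube,
    integral_finsetSum _ fun i _ => (hc4 i).integrableOn_cube, ← Finset.sum_neg_distrib]
  exact Finset.sum_congr rfl fun i _ => key i

theorem two_mul_abs_le_of_weight {w a b : ℝ} (hw : 0 < w) : 2 * |a * b| ≤ w * a ^ 2 + b ^ 2 / w := by
  rw [abs_mul, ← sq_abs a, ← sq_abs b]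
  have h : w * |a| ^ 2 + |b| ^ 2 / w - 2 * (|a| * |b|) = (w * |a| - |b|) ^ 2 / w := by
    field_simp; ring
  have : 0 ≤ (w * |a| - |b|) ^ 2 / w := by positivity
  linarith

open Filter Topology in
/-- The Bellman function decreases along the heat flow, fast enough to control any quantity `F`
whose time derivative is bounded by a mixed product of first derivatives. -/
theorem le_integral_of_heat_flow {B : ℝ × ℝ → ℝ} (hB : ContDiff ℝ 2 B) (hB0 : ∀ z, 0 ≤ B z)
    (hess : ∀ z, ∃ w > 0, ∀ a b, (w * a ^ 2 + b ^ 2 / w) / 16 ≤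
      fderiv ℝ (fderiv ℝ B) z (a, b) (a, b))
    (L M : TrigData n) (i j : Fin n) {F F' : ℝ → ℝ} (hF : ∀ t, HasDerivAt F (F' t) t)
    (hF' : ∀ t, |F' t| ≤ 2 * ∫ x in cube n,
      |eval (diff i (heat t L)) x * eval (diff j (heat t M)) x|)
    (hlim : Tendsto F atTop (𝓝 0)) :
    F 0 ≤ 16 * ∫ x in cube n, B (eval L x, eval M x) := by
  have hpair : ∀ L M : TrigData n, Continuous fun x => (eval L x, eval M x) := fun L M =>
    (continuous_eval L).prodMk (continuous_eval M)
  have hpairt : ∀ L M : TrigData n, Continuous fun z : ℝ × EuclideanSpace ℝ (Fin n) =>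
      (eval (heat z.1 L) z.2, eval (heat z.1 M) z.2) := fun L M =>
    (contDiff_heat L).continuous.prodMk (contDiff_heat M).continuous
  have hB1 : ContDiff ℝ 1 (fderiv ℝ B) := hB.fderiv_right (by norm_num)
  have hc2 : Continuous (fderiv ℝ (fderiv ℝ B)) := (hB1.continuous_fderiv one_ne_zero)
  have hI : ∀ t, HasDerivAt (fun t => ∫ x in cube n, B (eval (heat t L) x, eval (heat t M) x))
      (∫ x in cube n, fderiv ℝ B (eval (heat t L) x, eval (heat t M) x)
        (∑ i, eval (heat t (diff i (diff i L))) x, ∑ i, eval (heat t (diff i (diff i M))) x)) t := by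
    refine hasDerivAt_setIntegral_of_continuous (isCompact_cube n)
      (G := fun t x => B (eval (heat t L) x, eval (heat t M) x))
      (G' := fun t x => fderiv ℝ B (eval (heat t L) x, eval (heat t M) x)
        (∑ i, eval (heat t (diff i (diff i L))) x, ∑ i, eval (heat t (diff i (diff i M))) x))
      (fun t => hB.continuous.comp (hpair _ _)) ?_ ?_
    · refine (hB1.continuous.comp (hpairt L M)).clm_apply (Continuous.prodMk ?_ ?_) <;>
      exact continuous_finsetSum _ fun i _ => (contDiff_heat _).continuous
    · intro t x
      exact (hB.differentiable two_ne_zero _).hasFDerivAt.comp_hasDerivAt t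
        ((hasDerivAt_heat L x t).prodMk (hasDerivAt_heat M x t))
  have hdom : ∀ t, |F' t| ≤ -16 * ∫ x in cube n, fderiv ℝ B (eval (heat t L) x, eval (heat t M) x)
        (∑ i, eval (heat t (diff i (diff i L))) x,
          ∑ i, eval (heat t (diff i (diff i M))) x) := fun t => by
    have hc4 : Continuous fun x => ∑ k, fderiv ℝ (fderiv ℝ B) (eval (heat t L) x, eval (heat t M) x)
        (eval (diff k (heat t L)) x, eval (diff k (heat t M)) x)
        (eval (diff k (heat t L)) x, eval (diff k (heat t M)) x) :=
      continuous_finsetSum _ fun k _ =>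
        ((hc2.comp (hpair _ _)).clm_apply (hpair _ _)).clm_apply (hpair _ _)
    refine (hF' t).trans ?_
    simp only [← diff_heat]
    rw [integral_fderiv_lap hB, neg_mul_neg, ← integral_const_mul, ← integral_const_mul]
    refine setIntegral_mono_on
      (((continuous_eval _).mul (continuous_eval _)).abs.const_mul 2).integrableOn_cube
      (hc4.const_mul 16).integrableOn_cube (measurableSet_cube n) fun x _ => ?_
    obtain ⟨w, hw, h⟩ := hess (eval (heat t L) x, eval (heat t M) x)
    refine (two_mul_abs_le_of_weight hw).trans ?_
    calc _ ≤ ∑ k, (w * eval (diff k (heat t L)) x ^ 2 + eval (diff k (heat t M)) x ^ 2 / w) := by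
          rw [Finset.sum_add_distrib]
          exact add_le_add
            (Finset.single_le_sum (f := fun k => w * eval (diff k (heat t L)) x ^ 2)
              (fun k _ => by positivity) (Finset.mem_univ i))
            (Finset.single_le_sum (f := fun k => eval (diff k (heat t M)) x ^ 2 / w)
              (fun k _ => by positivity) (Finset.mem_univ j))
      _ ≤ _ := by
          rw [Finset.mul_sum]
          exact Finset.sum_le_sum fun k _ => by
            linarith [h (eval (diff k (heat t L)) x) (eval (diff k (heat t M)) x)]
  have hmono : Monotone fun t => F t - 16 * ∫ x in cube n, B (eval (heat t L) x, eval (heat t M) x) :=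
    monotone_of_hasDerivAt_nonneg (fun t => (hF t).sub ((hI t).const_mul 16)) fun t => by
      have := (abs_le.1 (hdom t)).1
      simp only [Pi.zero_apply]
      linarith
  have hle : ∀ t, 0 ≤ t → F 0 - 16 * ∫ x in cube n, B (eval L x, eval M x) ≤ F t := fun t ht => by
    have h1 := hmono ht
    have h2 : 0 ≤ ∫ x in cube n, B (eval (heat t L) x, eval (heat t M) x) :=
      setIntegral_nonneg (measurableSet_cube n) fun x _ => hB0 _
    simp only [heat_zero] at h1
    linarith
  have := ge_of_tendsto hlim (eventually_atTop.2 ⟨0, hle⟩)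
  linarith

theorem integral_lap_mul_heat (L M : TrigData n) (i j : Fin n) :
    ∫ x in cube n, ((∑ k, eval (diff k (diff k L)) x) * eval (diff i (diff j M)) x +
        eval L x * ∑ k, eval (diff k (diff k (diff i (diff j M)))) x) =
      -2 * ∫ x in cube n, eval (diff i L) x * eval (diff j (scale (fun k => -freq k) M)) x := by
  have h1 : ∫ x in cube n, eval L x * eval (scale (fun k => -freq k) (diff i (diff j M))) x =
      - ∫ x in cube n, eval (diff i L) x * eval (diff j (scale (fun k => -freq k) M)) x := by
    rw [← diff_scale, ← diff_scale, integral_diff_mul, neg_neg]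
  have h2 : ∫ x in cube n, eval (scale (fun k => -freq k) L) x * eval (diff i (diff j M)) x =
      ∫ x in cube n, eval L x * eval (scale (fun k => -freq k) (diff i (diff j M))) x := by
    simp only [eval_lap, Finset.sum_mul, Finset.mul_sum]
    rw [integral_finsetSum _ fun k _ => integrableOn_eval_mul _ _,
      integral_finsetSum _ fun k _ => integrableOn_eval_mul _ _]
    refine Finset.sum_congr rfl fun k _ => ?_
    rw [integral_diff_mul, integral_diff_mul, neg_neg]
  simp only [← eval_lap]
  rw [integral_add (integrableOn_eval_mul _ _) (integrableOn_eval_mul _ _), h2, h1]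
  ring

open Filter Topology in
theorem tendsto_integral_heat (L M : TrigData n) (i : Fin n) :
    Tendsto (fun t => ∫ x in cube n, eval (heat t L) x * eval (heat t (diff i M)) x)
      atTop (𝓝 0) := by
  obtain ⟨C, hC⟩ := exists_abs_heat_le L
  obtain ⟨D, hD⟩ := exists_abs_heat_le (diff i M)
  have : (0 : ℝ) = ∫ x in cube n, (0 : ℝ) := by simp
  rw [this]
  refine tendsto_integral_filter_of_dominated_convergence (fun _ => C * D) ?_ ?_ ?_ ?_
  · exact Eventually.of_forall fun t =>
      ((continuous_eval _).mul (continuous_eval _)).aestronglyMeasurable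
  · filter_upwards [eventually_ge_atTop 0] with t ht
    refine Eventually.of_forall fun x => ?_
    rw [Real.norm_eq_abs, abs_mul]
    exact mul_le_mul (hC t ht x) (hD t ht x) (abs_nonneg _) ((abs_nonneg _).trans (hC t ht x))
  · exact (continuous_const (y := C * D)).integrableOn_cube
  · refine Eventually.of_forall fun x => ?_
    have h := tendsto_heat_diff i M x
    refine squeeze_zero_norm' (a := fun t => C * |eval (heat t (diff i M)) x|) ?_ ?_
    · filter_upwards [eventually_ge_atTop 0] with t ht
      rw [Real.norm_eq_abs, abs_mul]
      exact mul_le_mul_of_nonneg_right (hC t ht x) (abs_nonneg _)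
    · simpa using (h.abs).const_mul C

theorem hasDerivAt_integral_heat (L M : TrigData n) (i j : Fin n) (t : ℝ) :
    HasDerivAt (fun t => ∫ x in cube n, eval (heat t L) x * eval (heat t (diff i (diff j M))) x)
      (-2 * ∫ x in cube n, eval (diff i (heat t L)) x *
        eval (diff j (heat t (scale (fun k => -freq k) M))) x) t := by
  have hsc : heat t (scale (fun k => -freq k) M) = scale (fun k => -freq k) (heat t M) := by
    simp only [heat, scale_scale, mul_comm]
  rw [hsc, ← integral_lap_mul_heat]
  refine (hasDerivAt_setIntegral_of_continuous (isCompact_cube n)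
    (G := fun t x => eval (heat t L) x * eval (heat t (diff i (diff j M))) x)
    (G' := fun t x => (∑ k, eval (heat t (diff k (diff k L))) x) * eval (heat t (diff i (diff j M))) x +
        eval (heat t L) x * ∑ k, eval (heat t (diff k (diff k (diff i (diff j M))))) x)
    (fun t => (continuous_eval _).mul (continuous_eval _)) ?_ ?_ t).congr_deriv ?_
  · exact ((continuous_finsetSum _ fun i _ => (contDiff_heat _).continuous).mul
      (contDiff_heat _).continuous).add ((contDiff_heat _).continuous.mul
      (continuous_finsetSum _ fun i _ => (contDiff_heat _).continuous))
  · intro t x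
    exact (hasDerivAt_heat L x t).mul (hasDerivAt_heat _ x t)
  · simp only [diff_heat]

theorem abs_setIntegral_le (L M : TrigData n) :
    |-2 * ∫ x in cube n, eval L x * eval M x| ≤ 2 * ∫ x in cube n, |eval L x * eval M x| := by
  rw [abs_mul]
  refine (congrArg (· * _) (by norm_num : |(-2 : ℝ)| = 2)).trans_le ?_
  refine mul_le_mul_of_nonneg_left ?_ zero_le_two
  exact abs_integral_le_integral_abs

/-- Young-type form of the dual `L^p`-estimate for second-order Riesz transforms of trigonometric
polynomials. -/
theorem exists_integral_mul_diff_diff_le {p q : ℝ} (hpq : p.HolderConjugate q) (n : ℕ) :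
    ∃ C > 0, ∀ (L M : TrigData n) (i j : Fin n),
      ∫ x in cube n, eval L x * eval (diff i (diff j M)) x ≤
        C * ((∫ x in cube n, |eval L x| ^ p) +
          ∫ x in cube n, |eval (scale (fun k => -freq k) M) x| ^ q) := by
  have hlim : ∀ {c S J : ℝ} {r s : ℝ}, 0 < r → 0 < s →
      (∀ ε > 0, J ≤ c * (S + (ε ^ (r / 2) + ε ^ (s / 2)) * (volume (cube n)).toReal)) →
      J ≤ c * S := by
    intro c S J r s hr hs h
    have h1 : ContinuousAt (fun ε : ℝ => c * (S + (ε ^ (r / 2) + ε ^ (s / 2)) *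
        (volume (cube n)).toReal)) 0 :=
      continuousAt_const.mul (continuousAt_const.add
        (((Real.continuousAt_rpow_const _ _ (Or.inr (by positivity))).add
        (Real.continuousAt_rpow_const _ _ (Or.inr (by positivity)))).mul continuousAt_const))
    have h2 := ge_of_tendsto (h1.tendsto.mono_left
      (nhdsWithin_le_nhds (s := Set.Ioi 0))) (by
        filter_upwards [self_mem_nhdsWithin] with ε hε using h ε hε)
    simpa [Real.zero_rpow, hr.ne', hs.ne'] using h2
  have main : ∀ {r s : ℝ} (hrs : r.HolderConjugate s) (hr : 2 ≤ r), ∃ C > 0,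
      ∀ (L M : TrigData n) (i j : Fin n) (F F' : ℝ → ℝ), (∀ t, HasDerivAt F (F' t) t) →
      (∀ t, |F' t| ≤ 2 * ∫ x in cube n,
        |eval (diff i (heat t L)) x * eval (diff j (heat t M)) x|) →
      Filter.Tendsto F Filter.atTop (nhds 0) →
      F 0 ≤ C * ((∫ x in cube n, |eval L x| ^ r) + ∫ x in cube n, |eval M x| ^ s) := by
    intro r s hrs hr
    have hs1 : 1 < s := hrs.symm.lt
    have hA : 0 ≤ 18 / (s - 1) := div_nonneg (by norm_num) (by linarith)
    obtain ⟨C, hC, hle⟩ := exists_bellman_le hrs hA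
    refine ⟨16 * C, by positivity, fun L M i j F F' hF hF' hFl => ?_⟩
    refine hlim (r := r) (s := s) (by linarith) (by linarith) fun ε hε => ?_
    have hBc := contDiff_bellman r s (18 / (s - 1)) hε
    have h1 := le_integral_of_heat_flow hBc
      (bellman_nonneg hA hε) (exists_weight_le_bellman_hessian hrs hr hε) L M i j hF hF' hFl
    refine h1.trans ?_
    rw [mul_assoc]
    refine mul_le_mul_of_nonneg_left ?_ (by norm_num)
    have hr0 : 0 < r := by linarith
    have hs0 : 0 < s := by linarith
    calc _ ≤ ∫ x in cube n, C * ((|eval L x| ^ r + |eval M x| ^ s) +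
            (ε ^ (r / 2) + ε ^ (s / 2))) :=
          setIntegral_mono_on (hBc.continuous.comp
            ((continuous_eval L).prodMk (continuous_eval M))).integrableOn_cube
            ((((integrableOn_abs_eval_rpow hr0 L).add (integrableOn_abs_eval_rpow hs0 M)).add
              (continuous_const.integrableOn_cube)).const_mul C) (measurableSet_cube n)
            fun x _ => hle ε hε _
      _ = _ := by
          have hadd : IntegrableOn (fun x => |eval L x| ^ r + |eval M x| ^ s) (cube n) :=
            (integrableOn_abs_eval_rpow hr0 L).add (integrableOn_abs_eval_rpow hs0 M)
          rw [integral_const_mul, integral_add hadd continuous_const.integrableOn_cube,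
            integral_add (integrableOn_abs_eval_rpow hr0 L) (integrableOn_abs_eval_rpow hs0 M)]
          simp [Measure.real, mul_comm]
  rcases le_total 2 p with h2 | h2
  · obtain ⟨C, hC, h⟩ := main hpq h2
    refine ⟨C, hC, fun L M i j => ?_⟩
    have := h L (scale (fun k => -freq k) M) i j _ _ (hasDerivAt_integral_heat L M i j)
      (fun t => abs_setIntegral_le _ _) (tendsto_integral_heat L (diff j M) i)
    simpa only [heat_zero] using this
  · have h2' : 2 ≤ q := by
      have := hpq.inv_add_inv_eq_one
      have h3 : (2 : ℝ)⁻¹ ≤ p⁻¹ := inv_anti₀ hpq.pos h2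
      have h4 : q⁻¹ ≤ (2 : ℝ)⁻¹ := by linarith
      exact (inv_le_inv₀ hpq.symm.pos (by norm_num)).1 h4
    obtain ⟨C, hC, h⟩ := main hpq.symm h2'
    refine ⟨C, hC, fun L M i j => ?_⟩
    have := h (scale (fun k => -freq k) M) L j i _ _ (hasDerivAt_integral_heat L M i j)
      (fun t => by
        simpa only [mul_comm (eval (diff j _) _)] using
          abs_setIntegral_le (diff i (heat t L)) (diff j (heat t (scale (fun k => -freq k) M))))
      (tendsto_integral_heat L (diff j M) i)
    rw [add_comm]
    simpa only [heat_zero] using this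

end TrigData

/-- `h` takes equal values at points of the cube that differ by a period. -/
def CubePeriodic {n : ℕ} (h : EuclideanSpace ℝ (Fin n) → ℝ) : Prop :=
  ∀ x ∈ cube n, ∀ y ∈ cube n, (∀ i, ∃ k : ℤ, x i = y i + 2 * k) → h x = h y

theorem TrigData.cubePeriodic_eval {n : ℕ} (L : TrigData n) : CubePeriodic (eval L) :=
  fun _ _ _ _ h => by
    choose k hk using h
    exact eval_periodic k L hk

theorem CubePeriodic.comp_left {n : ℕ} {h : EuclideanSpace ℝ (Fin n) → ℝ} (hh : CubePeriodic h)
    (g : ℝ → ℝ) : CubePeriodic fun x => g (h x) :=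
  fun x hx y hy hxy => congrArg g (hh x hx y hy hxy)

theorem cubePeriodic_of_eq_zero {n : ℕ} {h : EuclideanSpace ℝ (Fin n) → ℝ}
    (hh : ∀ x, 1 ≤ ‖x‖ → h x = 0) : CubePeriodic h := by
  intro x hx y hy hxy
  by_cases hne : x = y
  · rw [hne]
  obtain ⟨i, hi⟩ : ∃ i, x i ≠ y i := by
    by_contra! hcon
    exact hne (PiLp.ext hcon)
  obtain ⟨k, hk⟩ := hxy i
  have hk0 : k ≠ 0 := by rintro rfl; simp at hk; exact hi hk
  have hk1 : (1 : ℝ) ≤ |(k : ℝ)| := by exact_mod_cast Int.one_le_abs hk0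
  have hxi := mem_cube.1 hx i
  have hyi := mem_cube.1 hy i
  have h1 : 1 ≤ |x i| ∧ 1 ≤ |y i| := by
    rcases le_total 0 (k : ℝ) with h0 | h0
    · rw [abs_of_nonneg h0] at hk1
      exact ⟨le_abs.2 (Or.inl (by linarith [hyi.1])), le_abs.2 (Or.inr (by linarith [hxi.2]))⟩
    · rw [abs_of_nonpos h0] at hk1
      exact ⟨le_abs.2 (Or.inr (by linarith [hyi.2])), le_abs.2 (Or.inl (by linarith [hxi.1]))⟩
  have hn := fun z : EuclideanSpace ℝ (Fin n) => PiLp.norm_apply_le z i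
  rw [hh x (h1.1.trans (hn x)), hh y (h1.2.trans (hn y))]

/-- The covering map from the cube to the standard torus. -/
noncomputable def cubeToTorus {n : ℕ} (x : cube n) : UnitAddTorus (Fin n) :=
  fun i => ((x.1 i / 2 : ℝ) : UnitAddCircle)

theorem isQuotientMap_cubeToTorus {n : ℕ} :
    Topology.IsQuotientMap (cubeToTorus : cube n → UnitAddTorus (Fin n)) := by
  have hc : Continuous (cubeToTorus : cube n → UnitAddTorus (Fin n)) := by
    refine continuous_pi fun i => (AddCircle.continuous_mk' (1 : ℝ)).comp ?_
    fun_prop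
  have : CompactSpace (cube n) := isCompact_iff_compactSpace.1 (isCompact_cube n)
  refine hc.isClosedMap.isQuotientMap hc fun y => ?_
  have : ∀ i, ∃ t ∈ Set.Icc (-1 : ℝ) 1, ((t / 2 : ℝ) : UnitAddCircle) = y i := fun i => by
    obtain ⟨r, hr⟩ := QuotientAddGroup.mk_surjective (y i)
    refine ⟨2 * (r - round r), ?_, ?_⟩
    · have := abs_le.1 (abs_sub_round r)
      constructor <;> linarith [this.1, this.2]
    · rw [mul_div_cancel_left₀ _ (two_ne_zero' ℝ), ← hr]
      have h1 : ((round r : ℝ) : UnitAddCircle) = 0 := by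
        rw [AddCircle.coe_eq_zero_iff]
        exact ⟨round r, by simp⟩
      rw [AddCircle.coe_sub, h1, sub_zero]
  choose t ht hty using this
  exact ⟨⟨WithLp.toLp 2 t, mem_cube.2 ht⟩, funext hty⟩

theorem mFourier_cubeToTorus {n : ℕ} (k : Fin n → ℤ) (x : cube n) :
    UnitAddTorus.mFourier k (cubeToTorus x) =
      Complex.exp ((Real.pi * ∑ i, (k i : ℝ) * x.1 i : ℝ) * Complex.I) := by
  simp only [UnitAddTorus.mFourier, ContinuousMap.coe_mk, cubeToTorus]
  simp only [fourier_coe_apply, ← Complex.exp_sum]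
  congr 1
  push_cast
  rw [Finset.mul_sum, Finset.sum_mul]
  refine Finset.sum_congr rfl fun i _ => ?_
  field_simp

theorem exists_trigData_of_mem_span {n : ℕ} {g : C(UnitAddTorus (Fin n), ℂ)}
    (hg : g ∈ Submodule.span ℂ (Set.range (UnitAddTorus.mFourier (d := Fin n)))) (c : ℂ) :
    ∃ L : TrigData n, ∀ x : cube n, (c * g (cubeToTorus x)).re = L.eval x.1 := by
  induction hg using Submodule.span_induction generalizing c with
  | mem g hg =>
    obtain ⟨k, rfl⟩ := hg
    refine ⟨[(k, ‖c‖, c.arg)], fun x => ?_⟩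
    rw [mFourier_cubeToTorus]
    nth_rw 1 [← Complex.norm_mul_exp_arg_mul_I c]
    rw [mul_assoc, ← Complex.exp_add, ← add_mul, ← Complex.ofReal_add, Complex.re_ofReal_mul,
      Complex.exp_ofReal_mul_I_re]
    simp [TrigData.eval_cons, TrigData.term, add_comm]
  | zero => exact ⟨[], fun x => by simp⟩
  | add g g' _ _ h h' =>
    obtain ⟨L, hL⟩ := h c
    obtain ⟨L', hL'⟩ := h' c
    exact ⟨L ++ L', fun x => by
      rw [TrigData.eval_append, ← hL, ← hL', ContinuousMap.add_apply, mul_add, Complex.add_re]⟩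
  | smul a g _ h =>
    obtain ⟨L, hL⟩ := h (c * a)
    exact ⟨L, fun x => by rw [← hL, ContinuousMap.smul_apply, smul_eq_mul, mul_assoc]⟩

theorem exists_trigData_approx {n : ℕ} {h : EuclideanSpace ℝ (Fin n) → ℝ} (hc : Continuous h)
    (hp : CubePeriodic h) {ε : ℝ} (hε : 0 < ε) :
    ∃ L : TrigData n, ∀ x ∈ cube n, |L.eval x - h x| ≤ ε := by
  let h0 : C(cube n, ℂ) := ⟨fun x => (h x.1 : ℂ), by fun_prop⟩
  have hfac : Function.FactorsThrough h0 (cubeToTorus : cube n → UnitAddTorus (Fin n)) := by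
    intro x y hxy
    refine congrArg Complex.ofReal (hp x.1 x.2 y.1 y.2 fun i => ?_)
    have := congrFun hxy i
    simp only [cubeToTorus] at this
    rw [← sub_eq_zero, ← AddCircle.coe_sub, AddCircle.coe_eq_zero_iff] at this
    obtain ⟨k, hk⟩ := this
    refine ⟨k, ?_⟩
    simp at hk
    linarith
  let q : C(cube n, UnitAddTorus (Fin n)) := ⟨cubeToTorus, isQuotientMap_cubeToTorus.continuous⟩
  let H := Topology.IsQuotientMap.lift (f := q) isQuotientMap_cubeToTorus h0 hfac
  have hH : ∀ x : cube n, H (cubeToTorus x) = h x.1 := fun x =>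
    congrArg (fun g : C(cube n, ℂ) => g x)
      (Topology.IsQuotientMap.lift_comp (f := q) isQuotientMap_cubeToTorus h0 hfac)
  have hmem : H ∈ (Submodule.span ℂ (Set.range
      (UnitAddTorus.mFourier (d := Fin n)))).topologicalClosure := by
    rw [UnitAddTorus.span_mFourier_closure_eq_top]
    trivial
  obtain ⟨g, hg, hgH⟩ := Metric.mem_closure_iff.1 hmem ε hε
  obtain ⟨L, hL⟩ := exists_trigData_of_mem_span hg 1
  refine ⟨L, fun x hx => ?_⟩
  have h1 := hL ⟨x, hx⟩
  rw [one_mul] at h1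
  have h2 : h x = (H (cubeToTorus ⟨x, hx⟩)).re := by rw [hH]; rfl
  have h3 : dist H g ≤ ε := hgH.le
  rw [← h1, h2, ← Complex.sub_re]
  refine (Complex.abs_re_le_norm _).trans ?_
  rw [dist_comm, dist_eq_norm] at h3
  exact (ContinuousMap.norm_coe_le_norm (g - H) (cubeToTorus ⟨x, hx⟩)).trans h3

open Filter Topology in
theorem integral_mul_le_of_trigData {n : ℕ} {q C G : ℝ} (hq : 0 < q)
    {h g : EuclideanSpace ℝ (Fin n) → ℝ}
    (hh : Continuous h) (hg : Continuous g) (hgp : CubePeriodic g)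
    (H : ∀ L : TrigData n, ∫ x in cube n, h x * L.eval x ≤ C * (∫ x in cube n, |L.eval x| ^ q) + G) :
    ∫ x in cube n, h x * g x ≤ C * (∫ x in cube n, |g x| ^ q) + G := by
  choose L hL using fun k : ℕ => exists_trigData_approx hg hgp (ε := 1 / ((k : ℝ) + 1))
    (by positivity)
  obtain ⟨D, hD⟩ := (isCompact_cube n).exists_bound_of_continuousOn hg.continuousOn
  have hlim : ∀ x ∈ cube n, Tendsto (fun k => (L k).eval x) atTop (𝓝 (g x)) := fun x hx => by
    rw [tendsto_iff_norm_sub_tendsto_zero]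
    exact squeeze_zero (fun _ => norm_nonneg _) (fun k => hL k x hx)
      tendsto_one_div_add_atTop_nhds_zero_nat
  have hbd : ∀ k, ∀ x ∈ cube n, |(L k).eval x| ≤ D + 1 := fun k x hx => by
    have h1 := hL k x hx
    have h2 : 1 / ((k : ℝ) + 1) ≤ 1 := by
      rw [div_le_one (by positivity)]; linarith [(k.cast_nonneg : (0 : ℝ) ≤ k)]
    have h3 := hD x hx
    rw [Real.norm_eq_abs] at h3
    have h4 := abs_sub_abs_le_abs_sub ((L k).eval x) (g x)
    linarith
  have t1 : Tendsto (fun k => ∫ x in cube n, h x * (L k).eval x) atTop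
      (𝓝 (∫ x in cube n, h x * g x)) := by
    refine tendsto_integral_of_dominated_convergence (fun x => |h x| * (D + 1))
      (fun k => (hh.mul (L k).continuous_eval).aestronglyMeasurable)
      (hh.abs.mul continuous_const).integrableOn_cube (fun k => ?_) ?_
    · refine (ae_restrict_iff' (measurableSet_cube n)).2 (Eventually.of_forall fun x hx => ?_)
      rw [norm_mul]
      exact mul_le_mul_of_nonneg_left (hbd k x hx) (abs_nonneg _)
    · exact (ae_restrict_iff' (measurableSet_cube n)).2
        (Eventually.of_forall fun x hx => (hlim x hx).const_mul _)
  have t2 : Tendsto (fun k => ∫ x in cube n, |(L k).eval x| ^ q) atTop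
      (𝓝 (∫ x in cube n, |g x| ^ q)) := by
    refine tendsto_integral_of_dominated_convergence (fun x => (D + 1) ^ q)
      (fun k => (((L k).continuous_eval).abs.rpow_const fun _ => Or.inr hq.le).aestronglyMeasurable)
      continuous_const.integrableOn_cube (fun k => ?_) ?_
    · refine (ae_restrict_iff' (measurableSet_cube n)).2 (Eventually.of_forall fun x hx => ?_)
      rw [Real.norm_eq_abs, abs_of_nonneg (by positivity)]
      exact Real.rpow_le_rpow (abs_nonneg _) (hbd k x hx) hq.le
    · exact (ae_restrict_iff' (measurableSet_cube n)).2
        (Eventually.of_forall fun x hx => (hlim x hx).abs.rpow_const (Or.inr hq.le))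
  exact le_of_tendsto_of_tendsto' t1 ((t2.const_mul C).add_const G) fun k => H (L k)

/-- Duality: a function whose pairing with trigonometric polynomials is controlled in the sense of
Young's inequality is controlled in the conjugate norm. -/
theorem exists_integral_rpow_le_of_dual {p q : ℝ} (hpq : p.HolderConjugate q) {C : ℝ} (hC : 0 < C)
    (n : ℕ) :
    ∃ K > 0, ∀ (h : EuclideanSpace ℝ (Fin n) → ℝ) (G : ℝ), Continuous h → CubePeriodic h →
      (∀ L : TrigData n,
        ∫ x in cube n, h x * L.eval x ≤ C * (∫ x in cube n, |L.eval x| ^ q) + G) →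
      ∫ x in cube n, |h x| ^ p ≤ K * G := by
  have hp1 := hpq.lt
  have hq1 := hpq.symm.lt
  set l : ℝ := (1 / (2 * C)) ^ (1 / (q - 1)) with hl
  have hl0 : 0 < l := by positivity
  have hlq : C * l ^ q = l / 2 := by
    have h1 : l ^ (q - 1) = 1 / (2 * C) := by
      rw [hl, ← Real.rpow_mul (by positivity), one_div_mul_cancel (by linarith), Real.rpow_one]
    have h2 : l ^ q = l ^ (q - 1) * l := by
      rw [← Real.rpow_add_one hl0.ne', sub_add_cancel]
    rw [h2, h1]; field_simp
  refine ⟨2 / l, by positivity, fun h G hh hp H => ?_⟩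
  let s : ℝ → ℝ := fun y => (max y 0) ^ (p - 1) - (max (-y) 0) ^ (p - 1)
  have hs : Continuous s := by
    refine Continuous.sub ?_ ?_ <;>
    refine Continuous.rpow_const (by fun_prop) fun _ => Or.inr (by linarith)
  have hz : (0 : ℝ) ^ (p - 1) = 0 := Real.zero_rpow (by linarith)
  have hs_abs : ∀ y, |s y| = |y| ^ (p - 1) := fun y => by
    simp only [s]
    rcases le_total 0 y with hy | hy
    · rw [max_eq_left hy, max_eq_right (by linarith), hz, sub_zero, abs_of_nonneg hy,
        abs_of_nonneg (by positivity)]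
    · rw [max_eq_right hy, max_eq_left (by linarith), hz, zero_sub, abs_neg, abs_of_nonpos hy,
        abs_of_nonneg (Real.rpow_nonneg (by linarith) _)]
  have hs_mul : ∀ y, y * s y = |y| ^ p := fun y => by
    have hadd : ∀ z : ℝ, 0 ≤ z → z ^ p = z * z ^ (p - 1) := fun z hz => by
      conv_rhs => rw [← Real.rpow_one z, ← Real.rpow_mul hz, one_mul,
        ← Real.rpow_add_of_nonneg hz zero_le_one (by linarith)]
      congr 1; ring
    simp only [s]
    rcases le_total 0 y with hy | hy
    · rw [max_eq_left hy, max_eq_right (by linarith), hz, sub_zero, abs_of_nonneg hy, hadd y hy]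
    · rw [max_eq_right hy, max_eq_left (by linarith), hz, zero_sub, abs_of_nonpos hy,
        hadd (-y) (by linarith)]
      ring
  have key := integral_mul_le_of_trigData (g := fun x => l * s (h x)) hpq.symm.pos hh
    (continuous_const.mul (hs.comp hh)) (hp.comp_left fun y => l * s y) H
  have e1 : ∀ x, h x * (l * s (h x)) = l * |h x| ^ p := fun x => by
    rw [← hs_mul]; ring
  have e2 : ∀ x, |l * s (h x)| ^ q = l ^ q * |h x| ^ p := fun x => by
    rw [abs_mul, hs_abs, Real.mul_rpow (abs_nonneg _) (by positivity), abs_of_pos hl0,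
      ← Real.rpow_mul (abs_nonneg _)]
    congr 2
    have := hpq.sub_one_mul_conj
    linarith
  simp only [e1, e2, integral_const_mul] at key
  rw [← mul_assoc, hlq] at key
  rw [div_mul_eq_mul_div, le_div_iff₀ hl0]
  linarith

namespace TrigData

variable {n : ℕ}

theorem exists_integral_diff_diff_le {p q : ℝ} (hpq : p.HolderConjugate q) (n : ℕ) :
    ∃ C > 0, ∀ (M : TrigData n) (i j : Fin n),
      ∫ x in cube n, |eval (diff i (diff j M)) x| ^ q ≤
        C * ∫ x in cube n, |eval (scale (fun k => -freq k) M) x| ^ q := by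
  obtain ⟨C, hC, h⟩ := exists_integral_mul_diff_diff_le hpq n
  obtain ⟨K, hK, hdual⟩ := exists_integral_rpow_le_of_dual hpq.symm hC n
  refine ⟨K * C, by positivity, fun M i j => ?_⟩
  rw [mul_assoc]
  refine hdual _ _ (continuous_eval _) (cubePeriodic_eval _) fun L => ?_
  simpa only [mul_comm, mul_add] using h L M i j

theorem integral_diff_rpow_le {q : ℝ} (hq : 1 ≤ q) (M : TrigData n) (i : Fin n) :
    ∫ x in cube n, |eval (diff i M) x| ^ q ≤
      2 ^ q * ∫ x in cube n, |eval (diff i (diff i M)) x| ^ q := by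
  have hc : ∀ L : TrigData n, Continuous fun x => |eval L x| ^ q := fun L =>
    (continuous_eval L).abs.rpow_const fun _ => Or.inr (by linarith)
  rw [← integral_const_mul]
  refine setIntegral_cube_mono_of_slices i (hc _) ((hc _).const_mul _) fun x => ?_
  rw [intervalIntegral.integral_const_mul]
  refine intervalIntegral_abs_rpow_le_deriv hq (fun s => hasDerivAt_eval_line i M x s)
    (fun s => hasDerivAt_eval_line i (diff i M) x s)
    ((continuous_eval _).comp (by fun_prop)) ?_
  rw [← eval_add_two_smul i, add_assoc, ← add_smul]
  norm_num

theorem eq_zero_of_freq_eq_zero {k : Fin n → ℤ} (hk : freq k = 0) : k = 0 := by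
  funext i
  have h := (Finset.sum_eq_zero_iff_of_nonneg fun i _ => sq_nonneg (Real.pi * k i)).1 hk i
    (Finset.mem_univ i)
  have := Real.pi_ne_zero
  simpa [this] using h

theorem exists_eval_scale_ite_eq_const (L : TrigData n) :
    ∃ c, ∀ x, eval (scale (fun k => if freq k = 0 then 1 else 0) L) x = c := by
  induction L with
  | nil => exact ⟨0, fun x => rfl⟩
  | cons m L ih =>
    obtain ⟨c, hc⟩ := ih
    by_cases hm : freq m.1 = 0
    · refine ⟨m.2.1 * Real.cos m.2.2 + c, fun x => ?_⟩
      simp only [scale, List.map_cons, eval_cons, term, if_pos hm] at hc ⊢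
      rw [hc, eq_zero_of_freq_eq_zero hm]
      simp
    · refine ⟨c, fun x => ?_⟩
      simp only [scale, List.map_cons, eval_cons, term, if_neg hm] at hc ⊢
      rw [hc]
      simp

/-- Every trigonometric polynomial is the Laplacian of another one, up to a constant. -/
theorem exists_eq_const_add_lap (L : TrigData n) :
    ∃ (c : ℝ) (M : TrigData n), ∀ x, eval L x = c + eval (scale (fun k => -freq k) M) x := by
  obtain ⟨c, hc⟩ := exists_eval_scale_ite_eq_const L
  refine ⟨c, scale (fun k => -(freq k)⁻¹) L, fun x => ?_⟩
  rw [← hc x, scale_scale, ← eval_scale_add]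
  conv_lhs => rw [← scale_one L]
  congr 3
  funext k
  by_cases hk : freq k = 0
  · simp [hk]
  · simp [hk]

theorem integral_lap_eq_zero (M : TrigData n) :
    ∫ x in cube n, eval (scale (fun k => -freq k) M) x = 0 := by
  simp only [eval_lap]
  rw [integral_finsetSum _ fun i _ => (continuous_eval _).integrableOn_cube]
  exact Finset.sum_eq_zero fun i _ => setIntegral_cube_deriv_eq_zero i (continuous_eval _)
    (fun x s => hasDerivAt_eval_line i (diff i M) x s) (fun x => eval_add_two_smul _ _ _)

end TrigData

theorem volume_cube_pos (n : ℕ) : 0 < volume (cube n) := by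
  refine (measure_ball_pos volume (0 : EuclideanSpace ℝ (Fin n)) one_pos).trans_le
    (measure_mono fun x hx => mem_cube.2 fun i => abs_le.1 ?_)
  exact (PiLp.norm_apply_le x i).trans (mem_ball_zero_iff.1 hx).le

theorem integral_abs_average_rpow_le {n : ℕ} {q : ℝ} (hq : 1 ≤ q)
    {f : EuclideanSpace ℝ (Fin n) → ℝ} (hf : Continuous f) {c : ℝ}
    (hc : ∫ _ in cube n, c = ∫ x in cube n, f x) :
    ∫ _ in cube n, |c| ^ q ≤ ∫ x in cube n, |f x| ^ q := by
  have hv : 0 < volume.real (cube n) :=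
    ENNReal.toReal_pos (volume_cube_pos n).ne' (isCompact_cube n).measure_lt_top.ne
  have hcf : |c| ≤ ⨍ x in cube n, |f x| := by
    rw [setAverage_eq, smul_eq_mul, ← div_eq_inv_mul, le_div_iff₀ hv]
    rw [setIntegral_const, smul_eq_mul] at hc
    calc |c| * volume.real (cube n) = |∫ x in cube n, f x| := by
          rw [← hc, abs_mul, abs_of_pos hv, mul_comm]
      _ ≤ _ := abs_integral_le_integral_abs
  have hj := (convexOn_rpow hq).map_set_average_le
    (Real.continuous_rpow_const (by linarith)).continuousOn isClosed_Ici (volume_cube_pos n).ne'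
    (isCompact_cube n).measure_lt_top.ne (f := fun x => |f x|)
    (Filter.Eventually.of_forall fun x => Set.mem_Ici.2 (abs_nonneg _)) hf.abs.integrableOn_cube
    (hf.abs.rpow_const fun _ => Or.inr (by linarith)).integrableOn_cube
  have h1 := (Real.rpow_le_rpow (abs_nonneg c) hcf (by linarith)).trans hj
  rw [setAverage_eq, smul_eq_mul, ← div_eq_inv_mul, le_div_iff₀ hv] at h1
  rw [setIntegral_const, smul_eq_mul, mul_comm]
  exact h1

theorem abs_add_rpow_le {q : ℝ} (hq : 0 ≤ q) (a b : ℝ) :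
    |a + b| ^ q ≤ 2 ^ q * (|a| ^ q + |b| ^ q) := by
  have h1 : |a + b| ≤ 2 * max |a| |b| :=
    (abs_add_le a b).trans (by linarith [le_max_left |a| |b|, le_max_right |a| |b|])
  refine (Real.rpow_le_rpow (abs_nonneg _) h1 hq).trans ?_
  rw [Real.mul_rpow zero_le_two (le_max_of_le_left (abs_nonneg _))]
  refine mul_le_mul_of_nonneg_left ?_ (by positivity)
  rcases max_choice |a| |b| with h | h <;> rw [h]
  · linarith [Real.rpow_nonneg (abs_nonneg b) q]
  · linarith [Real.rpow_nonneg (abs_nonneg a) q]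

namespace TrigData

/-- Periodic Calderón–Zygmund estimate: every trigonometric polynomial is, up to a constant, the
Laplacian of one whose first and second derivatives it controls. -/
theorem exists_lap_potential {p q : ℝ} (hpq : p.HolderConjugate q) (n : ℕ) :
    ∃ C > 0, ∀ L : TrigData n, ∃ (c : ℝ) (M : TrigData n),
      (∀ x, eval L x = c + ∑ k, eval (diff k (diff k M)) x) ∧
      (∀ i, ∫ x in cube n, |eval (diff i M) x| ^ q ≤ C * ∫ x in cube n, |eval L x| ^ q) ∧
      ∀ i j, ∫ x in cube n, |eval (diff i (diff j M)) x| ^ q ≤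
        C * ∫ x in cube n, |eval L x| ^ q := by
  have hq := hpq.symm.lt
  obtain ⟨C, hC, h⟩ := exists_integral_diff_diff_le hpq n
  have h2 : (1 : ℝ) ≤ 2 ^ q := Real.one_le_rpow one_le_two (by linarith)
  refine ⟨2 ^ q * (C * (2 ^ q * 2)), by positivity, fun L => ?_⟩
  obtain ⟨c, M, hM⟩ := exists_eq_const_add_lap L
  have hcM : ∫ _ in cube n, c = ∫ x in cube n, eval L x := by
    simp only [hM]
    rw [integral_add continuous_const.integrableOn_cube (continuous_eval _).integrableOn_cube,
      integral_lap_eq_zero, add_zero]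
  have hcq := integral_abs_average_rpow_le hq.le (continuous_eval L) hcM
  have hlap : ∫ x in cube n, |eval (scale (fun k => -freq k) M) x| ^ q ≤
      2 ^ q * 2 * ∫ x in cube n, |eval L x| ^ q := by
    have hcc : IntegrableOn (fun _ : EuclideanSpace ℝ (Fin n) => |c| ^ q) (cube n) :=
      continuous_const.integrableOn_cube
    have hLi := integrableOn_abs_eval_rpow (by linarith : 0 < q) L
    calc _ ≤ ∫ x in cube n, 2 ^ q * (|eval L x| ^ q + |c| ^ q) := by
          refine setIntegral_mono_on (integrableOn_abs_eval_rpow (by linarith) _)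
            ((hLi.add hcc).const_mul _) (measurableSet_cube n) fun x _ => ?_
          have := abs_add_rpow_le (by linarith : 0 ≤ q) (eval L x) (-c)
          rw [abs_neg] at this
          rwa [show eval (scale (fun k => -freq k) M) x = eval L x + -c by rw [hM]; ring]
      _ = 2 ^ q * ((∫ x in cube n, |eval L x| ^ q) + ∫ _ in cube n, |c| ^ q) := by
          rw [integral_const_mul, integral_add hLi hcc]
      _ ≤ _ := by
          rw [mul_assoc]
          refine mul_le_mul_of_nonneg_left ?_ (by positivity)
          linarith
  have hd : ∀ i j, ∫ x in cube n, |eval (diff i (diff j M)) x| ^ q ≤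
      C * (2 ^ q * 2) * ∫ x in cube n, |eval L x| ^ q := fun i j => by
    rw [mul_assoc]
    exact (h M i j).trans (mul_le_mul_of_nonneg_left hlap hC.le)
  have hL0 : 0 ≤ ∫ x in cube n, |eval L x| ^ q :=
    setIntegral_nonneg (measurableSet_cube n) fun x _ => by positivity
  refine ⟨c, M, fun x => by rw [hM, eval_lap], fun i => ?_, fun i j => (hd i j).trans ?_⟩
  · rw [mul_assoc]
    exact (integral_diff_rpow_le hq.le M i).trans
      (mul_le_mul_of_nonneg_left (hd i i) (by positivity))
  · rw [mul_assoc (2 ^ q)]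
    exact le_mul_of_one_le_left (by positivity) h2

end TrigData

section Smooth

variable {n : ℕ} {u v : EuclideanSpace ℝ (Fin n) → ℝ}

theorem ContDiff.partialDeriv' (hu : ContDiff ℝ (⊤ : ℕ∞) u) (i : Fin n) :
    ContDiff ℝ (⊤ : ℕ∞) (partialDeriv' i u) :=
  (hu.fderiv_right (m := (⊤ : ℕ∞)) (by simp)).clm_apply contDiff_const

theorem ContDiff.differentiable_top (hu : ContDiff ℝ (⊤ : ℕ∞) u) : Differentiable ℝ u :=
  hu.differentiable (by simp)

theorem partialDeriv'_mul (hu : ContDiff ℝ (⊤ : ℕ∞) u) (hv : ContDiff ℝ (⊤ : ℕ∞) v) (i : Fin n) :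
    partialDeriv' i (fun x => u x * v x) =
      fun x => partialDeriv' i u x * v x + u x * partialDeriv' i v x := by
  funext x
  simp only [partialDeriv']
  rw [fderiv_fun_mul (hu.differentiable_top x) (hv.differentiable_top x)]
  simp [mul_comm, add_comm]

theorem partialDeriv'_congr {s : Set (EuclideanSpace ℝ (Fin n))} (hs : IsOpen s)
    (h : ∀ x ∈ s, u x = v x) (i : Fin n) : ∀ x ∈ s, partialDeriv' i u x = partialDeriv' i v x := by
  intro x hx
  have : u =ᶠ[nhds x] v := by
    filter_upwards [hs.mem_nhds hx] with y hy using h y hy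
  simp only [partialDeriv', this.fderiv_eq]

theorem hessEntry_congr {s : Set (EuclideanSpace ℝ (Fin n))} (hs : IsOpen s)
    (h : ∀ x ∈ s, u x = v x) (i j : Fin n) : ∀ x ∈ s, hessEntry u i j x = hessEntry v i j x :=
  partialDeriv'_congr hs (partialDeriv'_congr hs h i) j

theorem partialDeriv'_eq_zero {s : Set (EuclideanSpace ℝ (Fin n))} (hs : IsClosed s)
    (h : ∀ x, x ∉ s → u x = 0) (i : Fin n) : ∀ x, x ∉ s → partialDeriv' i u x = 0 := by
  intro x hx
  rw [partialDeriv'_congr hs.isOpen_compl (v := fun _ => 0) h i x hx]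
  simp [partialDeriv']

theorem integrable_of_eq_zero {s : Set (EuclideanSpace ℝ (Fin n))} (hs : IsCompact s)
    (hu : Continuous u) (h : ∀ x, x ∉ s → u x = 0) : Integrable u :=
  hu.integrable_of_hasCompactSupport (HasCompactSupport.intro hs h)

theorem integral_partialDeriv'_mul {s : Set (EuclideanSpace ℝ (Fin n))} (hs : IsCompact s)
    (hu : ContDiff ℝ (⊤ : ℕ∞) u) (hv : ContDiff ℝ (⊤ : ℕ∞) v) (h : ∀ x, x ∉ s → u x = 0)
    (i : Fin n) : ∫ x, partialDeriv' i u x * v x = -∫ x, u x * partialDeriv' i v x := by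
  have h' := partialDeriv'_eq_zero hs.isClosed h i
  have := integral_mul_fderiv_eq_neg_fderiv_mul_of_integrable (μ := volume)
    (v := EuclideanSpace.single i (1 : ℝ)) (f := u) (g := v)
    (integrable_of_eq_zero hs ((hu.partialDeriv' i).continuous.mul hv.continuous)
      fun x hx => mul_eq_zero_of_left (h' x hx) _)
    (integrable_of_eq_zero hs (hu.continuous.mul (hv.partialDeriv' i).continuous)
      fun x hx => by rw [h x hx, zero_mul])
    (integrable_of_eq_zero hs (hu.continuous.mul hv.continuous)
      fun x hx => by rw [h x hx, zero_mul])
    (fun x _ => hu.differentiable_top x) (fun x _ => hv.differentiable_top x)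
  simp only [partialDeriv']
  rw [this, neg_neg]

theorem closedBall_subset_cube {r : ℝ} (hr : r ≤ 1) :
    closedBall (0 : EuclideanSpace ℝ (Fin n)) r ⊆ cube n := fun x hx =>
  mem_cube.2 fun i => abs_le.1 ((PiLp.norm_apply_le x i).trans
    ((mem_closedBall_zero_iff.1 hx).trans hr))

theorem integral_eq_setIntegral_cube {r : ℝ} (hr : r ≤ 1)
    (h : ∀ x, x ∉ closedBall (0 : EuclideanSpace ℝ (Fin n)) r → u x = 0) :
    ∫ x, u x = ∫ x in cube n, u x :=
  (setIntegral_eq_integral_of_forall_compl_eq_zero fun x hx => h x fun hx' =>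
    hx (closedBall_subset_cube hr hx')).symm

theorem CubePeriodic.of_closedBall {r : ℝ} (hr : r < 1)
    (h : ∀ x, x ∉ closedBall (0 : EuclideanSpace ℝ (Fin n)) r → u x = 0) : CubePeriodic u :=
  cubePeriodic_of_eq_zero fun x hx => h x fun hx' => by
    rw [mem_closedBall_zero_iff] at hx'
    linarith

/-- Integrated Young inequality with a bounded, compactly supported weight. -/
theorem integral_weight_mul_le {p q : ℝ} (hpq : p.HolderConjugate q) {r K : ℝ} (hr : r ≤ 1)
    {a b g : EuclideanSpace ℝ (Fin n) → ℝ} (hb : Continuous b)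
    (hg : Continuous g) (hK : ∀ x, |a x| ≤ K)
    (h : ∀ x, x ∉ closedBall (0 : EuclideanSpace ℝ (Fin n)) r → a x = 0) :
    |∫ x, a x * b x * g x| ≤
      K * ((∫ x in closedBall 0 r, |b x| ^ p) + ∫ x in cube n, |g x| ^ q) := by
  have hK0 : 0 ≤ K := (abs_nonneg _).trans (hK 0)
  have hbp : Continuous fun x => |b x| ^ p := hb.abs.rpow_const fun _ => Or.inr hpq.nonneg
  have hgq : Continuous fun x => |g x| ^ q := hg.abs.rpow_const fun _ => Or.inr hpq.symm.nonneg
  have hS := isCompact_closedBall (0 : EuclideanSpace ℝ (Fin n)) r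
  have h1 : ∫ x, a x * b x * g x = ∫ x in closedBall 0 r, a x * b x * g x :=
    (setIntegral_eq_integral_of_forall_compl_eq_zero fun x hx => by
      rw [h x hx, zero_mul, zero_mul]).symm
  rw [h1]
  have h2 : ∀ x, |a x * b x * g x| ≤ K * (|b x| ^ p + |g x| ^ q) := fun x => by
    rw [mul_assoc, abs_mul, abs_mul]
    refine mul_le_mul (hK x) ?_ (by positivity) hK0
    refine (Real.young_inequality_of_nonneg (abs_nonneg _) (abs_nonneg _) hpq).trans ?_
    exact add_le_add (div_le_self (by positivity) hpq.lt.le)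
      (div_le_self (by positivity) hpq.symm.lt.le)
  have hbi : IntegrableOn (fun x => |b x| ^ p) (closedBall 0 r) :=
    hbp.continuousOn.integrableOn_compact hS
  have hgi : IntegrableOn (fun x => |g x| ^ q) (closedBall 0 r) :=
    hgq.continuousOn.integrableOn_compact hS
  have h3 : |∫ x in closedBall 0 r, a x * b x * g x| ≤
      ∫ x in closedBall 0 r, K * (|b x| ^ p + |g x| ^ q) := by
    rw [← Real.norm_eq_abs]
    exact norm_integral_le_of_norm_le ((hbi.add hgi).const_mul K) (Filter.Eventually.of_forall h2)
  refine h3.trans ?_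
  rw [integral_const_mul, integral_add hbi hgi]
  refine mul_le_mul_of_nonneg_left (add_le_add le_rfl ?_) hK0
  exact setIntegral_mono_set hgq.integrableOn_cube
    (Filter.Eventually.of_forall fun x => by simp only [Pi.zero_apply]; positivity)
    (Filter.Eventually.of_forall (closedBall_subset_cube hr))

theorem integral_cutoff_mul {r : ℝ} {η χ : EuclideanSpace ℝ (Fin n) → ℝ}
    (hη : ContDiff ℝ (⊤ : ℕ∞) η) (h : ∀ x, x ∉ closedBall (0 : EuclideanSpace ℝ (Fin n)) r → η x = 0)
    (hu : ContDiff ℝ (⊤ : ℕ∞) u) (hχ : ContDiff ℝ (⊤ : ℕ∞) χ) (k : Fin n) :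
    ∫ x, η x * u x * hessEntry χ k k x =
      (∫ x, η x * hessEntry u k k x * χ x) - 2 * (∫ x, partialDeriv' k η x * u x * partialDeriv' k χ x)
        - ∫ x, hessEntry η k k x * u x * χ x := by
  have hS := isCompact_closedBall (0 : EuclideanSpace ℝ (Fin n)) r
  have hη' := hη.partialDeriv' k
  have hu' := hu.partialDeriv' k
  have hχ' := hχ.partialDeriv' k
  have h' := partialDeriv'_eq_zero hS.isClosed h k
  have h'' := partialDeriv'_eq_zero hS.isClosed h' k
  have hi : ∀ {a b c : EuclideanSpace ℝ (Fin n) → ℝ}, ContDiff ℝ (⊤ : ℕ∞) a →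
      ContDiff ℝ (⊤ : ℕ∞) b → ContDiff ℝ (⊤ : ℕ∞) c →
      (∀ x, x ∉ closedBall (0 : EuclideanSpace ℝ (Fin n)) r → a x = 0) →
      Integrable fun x => a x * b x * c x := fun ha hb hc h =>
    integrable_of_eq_zero hS ((ha.continuous.mul hb.continuous).mul hc.continuous)
      fun x hx => by rw [h x hx, zero_mul, zero_mul]
  have e1 := integral_partialDeriv'_mul hS (hη.mul hu) hχ' (fun x hx => by simp [h x hx]) k
  have e2 := integral_partialDeriv'_mul hS (hη.mul hχ) hu' (fun x hx => by simp [h x hx]) k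
  have e3 := integral_partialDeriv'_mul hS (hη'.mul hχ) hu (fun x hx => by simp [h' x hx]) k
  rw [partialDeriv'_mul hη hu] at e1
  rw [partialDeriv'_mul hη hχ] at e2
  rw [partialDeriv'_mul hη' hχ] at e3
  beta_reduce at e1 e2 e3
  have f1 : ∫ x, (partialDeriv' k η x * u x + η x * partialDeriv' k u x) * partialDeriv' k χ x =
      (∫ x, partialDeriv' k η x * u x * partialDeriv' k χ x) +
        ∫ x, η x * partialDeriv' k u x * partialDeriv' k χ x := by
    rw [← integral_add (hi hη' hu hχ' h') (hi hη hu' hχ' h)]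
    simp only [add_mul]
  have f2 : ∫ x, (partialDeriv' k η x * χ x + η x * partialDeriv' k χ x) * partialDeriv' k u x =
      (∫ x, partialDeriv' k η x * χ x * partialDeriv' k u x) +
        ∫ x, η x * partialDeriv' k u x * partialDeriv' k χ x := by
    rw [← integral_add (hi hη' hχ hu' h') (hi hη hu' hχ' h)]
    congr 1; funext x; ring
  have f3 : ∫ x, (partialDeriv' k (partialDeriv' k η) x * χ x +
        partialDeriv' k η x * partialDeriv' k χ x) * u x =
      (∫ x, hessEntry η k k x * u x * χ x) +
        ∫ x, partialDeriv' k η x * u x * partialDeriv' k χ x := by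
    simp only [hessEntry]
    rw [← integral_add (hi (hη'.partialDeriv' k) hu hχ h'') (hi hη' hu hχ' h')]
    congr 1; funext x; ring
  have f4 : ∫ x, η x * χ x * partialDeriv' k (partialDeriv' k u) x =
      ∫ x, η x * hessEntry u k k x * χ x := by
    congr 1; funext x; simp only [hessEntry]; ring
  simp only [hessEntry] at f3 f4 ⊢
  linarith

end Smooth

section Estimates

variable {n : ℕ} {u v : EuclideanSpace ℝ (Fin n) → ℝ}

theorem TrigData.hessEntry_eval (L : TrigData n) (i j : Fin n) :
    hessEntry (eval L) i j = eval (diff j (diff i L)) := by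
  simp only [hessEntry, partialDeriv'_eval]

theorem TrigData.partialDeriv'_const_add_eval {L N : TrigData n} {c : ℝ}
    (h : ∀ x, eval L x = c + eval N x) (i : Fin n) :
    partialDeriv' i (eval L) = eval (diff i N) := by
  rw [← partialDeriv'_eval, funext h]
  funext x
  simp only [partialDeriv', fderiv_const_add]

theorem ContDiff.hessEntry (hu : ContDiff ℝ (⊤ : ℕ∞) u) (i j : Fin n) :
    ContDiff ℝ (⊤ : ℕ∞) (hessEntry u i j) :=
  (hu.partialDeriv' i).partialDeriv' j

theorem ContDiff.continuous_lap (hu : ContDiff ℝ (⊤ : ℕ∞) u) : Continuous (lap u) :=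
  continuous_finsetSum _ fun i _ => (hu.hessEntry i i).continuous

theorem hessEntry_eq_zero {s : Set (EuclideanSpace ℝ (Fin n))} (hs : IsClosed s)
    (h : ∀ x, x ∉ s → u x = 0) (i j : Fin n) : ∀ x, x ∉ s → hessEntry u i j x = 0 :=
  partialDeriv'_eq_zero hs (partialDeriv'_eq_zero hs h i) j

theorem integral_hessEntry_mul {s : Set (EuclideanSpace ℝ (Fin n))} (hs : IsCompact s)
    (hu : ContDiff ℝ (⊤ : ℕ∞) u) (hv : ContDiff ℝ (⊤ : ℕ∞) v) (h : ∀ x, x ∉ s → u x = 0)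
    (i j : Fin n) : ∫ x, hessEntry u i j x * v x = ∫ x, u x * hessEntry v j i x := by
  simp only [hessEntry]
  rw [integral_partialDeriv'_mul hs (hu.partialDeriv' i) hv
    (partialDeriv'_eq_zero hs.isClosed h i) j,
    integral_partialDeriv'_mul hs hu (hv.partialDeriv' j) h i, neg_neg]

theorem exists_bound_derivatives {s : Set (EuclideanSpace ℝ (Fin n))} (hs : IsCompact s)
    (hu : ContDiff ℝ (⊤ : ℕ∞) u) (h : ∀ x, x ∉ s → u x = 0) :
    ∃ K > 0, (∀ x, |u x| ≤ K) ∧ (∀ k x, |partialDeriv' k u x| ≤ K) ∧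
      ∀ k x, |hessEntry u k k x| ≤ K := by
  obtain ⟨D, hD⟩ := hs.exists_bound_of_continuousOn (f := fun x => |u x| +
    ∑ k, |partialDeriv' k u x| + ∑ k, |hessEntry u k k x|) (by
      refine ((hu.continuous.abs.add ?_).add ?_).continuousOn
      · exact continuous_finsetSum _ fun k _ => (hu.partialDeriv' k).continuous.abs
      · exact continuous_finsetSum _ fun k _ => (hu.hessEntry k k).continuous.abs)
  have h' := partialDeriv'_eq_zero hs.isClosed h
  have h'' := hessEntry_eq_zero hs.isClosed h
  have p1 : ∀ x, 0 ≤ ∑ k, |partialDeriv' k u x| := fun x => Finset.sum_nonneg fun k _ => abs_nonneg _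
  have p2 : ∀ x, 0 ≤ ∑ k, |hessEntry u k k x| := fun x => Finset.sum_nonneg fun k _ => abs_nonneg _
  have hD' : ∀ x, |u x| + ∑ k, |partialDeriv' k u x| + ∑ k, |hessEntry u k k x| ≤ max D 1 :=
    fun x => by
      by_cases hx : x ∈ s
      · exact (le_abs_self _).trans ((hD x hx).trans (le_max_left _ _))
      · simp [h x hx, h' _ x hx, h'' _ _ x hx]
  refine ⟨max D 1, by positivity, fun x => ?_, fun k x => ?_, fun k x => ?_⟩
  · linarith [hD' x, p1 x, p2 x]
  · have := Finset.single_le_sum (f := fun k => |partialDeriv' k u x|)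
      (fun k _ => abs_nonneg _) (Finset.mem_univ k)
    linarith [hD' x, p1 x, p2 x, abs_nonneg (u x)]
  · have := Finset.single_le_sum (f := fun k => |hessEntry u k k x|)
      (fun k _ => abs_nonneg _) (Finset.mem_univ k)
    linarith [hD' x, p1 x, p2 x, abs_nonneg (u x)]

theorem exists_gradient_estimate {p q : ℝ} (hpq : p.HolderConjugate q) {r : ℝ} (hr : r < 1)
    {η : EuclideanSpace ℝ (Fin n) → ℝ} (hη : ContDiff ℝ (⊤ : ℕ∞) η)
    (h : ∀ x, x ∉ closedBall (0 : EuclideanSpace ℝ (Fin n)) r → η x = 0) :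
    ∃ C > 0, ∀ u : EuclideanSpace ℝ (Fin n) → ℝ, ContDiff ℝ (⊤ : ℕ∞) u → ∀ i,
      ∫ x in cube n, |partialDeriv' i (fun x => η x * u x) x| ^ p ≤
        C * ((∫ x in closedBall 0 r, |u x| ^ p) + ∫ x in closedBall 0 r, |lap u x| ^ p) := by
  have hS := isCompact_closedBall (0 : EuclideanSpace ℝ (Fin n)) r
  obtain ⟨K, hK, hK0, hK1, hK2⟩ := exists_bound_derivatives hS hη h
  obtain ⟨C, hC, hpot⟩ := TrigData.exists_lap_potential hpq n
  have h' := partialDeriv'_eq_zero hS.isClosed h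
  have h'' := hessEntry_eq_zero hS.isClosed h
  obtain ⟨D, hD, hdual⟩ := exists_integral_rpow_le_of_dual hpq
    (C := (1 + 3 * n) * K * C) (by positivity) n
  refine ⟨D * ((1 + 3 * n) * K), by positivity, fun u hu i => ?_⟩
  rw [mul_assoc]
  have hφ : ContDiff ℝ (⊤ : ℕ∞) fun x => η x * u x := hη.mul hu
  have hφ0 : ∀ x, x ∉ closedBall (0 : EuclideanSpace ℝ (Fin n)) r → η x * u x = 0 :=
    fun x hx => mul_eq_zero_of_left (h x hx) _
  have hφ1 := partialDeriv'_eq_zero hS.isClosed hφ0 i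
  refine hdual _ _ (hφ.partialDeriv' i).continuous (CubePeriodic.of_closedBall hr hφ1) fun L => ?_
  obtain ⟨c, M, hL, hM1, hM2⟩ := hpot L
  simp only [← TrigData.eval_lap] at hL
  set χ := TrigData.eval (TrigData.diff i M) with hχ_def
  have hχ : ContDiff ℝ (⊤ : ℕ∞) χ := TrigData.contDiff_eval _
  have e0 : ∀ x, partialDeriv' i (TrigData.eval L) x = ∑ k, hessEntry χ k k x := fun x => by
    rw [TrigData.partialDeriv'_const_add_eval hL, TrigData.diff_scale, TrigData.eval_lap]
    simp only [hχ_def, TrigData.hessEntry_eval]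
  have e1 : ∫ x in cube n, partialDeriv' i (fun x => η x * u x) x * TrigData.eval L x =
      -∑ k, ∫ x, η x * u x * hessEntry χ k k x := by
    rw [← integral_eq_setIntegral_cube hr.le fun x hx => mul_eq_zero_of_left (hφ1 x hx) _,
      integral_partialDeriv'_mul hS hφ (TrigData.contDiff_eval L) hφ0 i]
    simp only [e0, Finset.mul_sum]
    rw [integral_finsetSum]
    exact fun k _ => integrable_of_eq_zero hS
      (hφ.continuous.mul (hχ.hessEntry k k).continuous) fun x hx => mul_eq_zero_of_left (hφ0 x hx) _
  have e2 : ∑ k, ∫ x, η x * hessEntry u k k x * χ x = ∫ x, η x * lap u x * χ x := by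
    rw [← integral_finsetSum]
    · simp only [lap, Finset.mul_sum, Finset.sum_mul]
    · exact fun k _ => integrable_of_eq_zero hS
        ((hη.continuous.mul (hu.hessEntry k k).continuous).mul hχ.continuous) fun x hx => by
          rw [h x hx, zero_mul, zero_mul]
  rw [e1]
  simp only [integral_cutoff_mul hη h hu hχ, Finset.sum_sub_distrib, e2, ← Finset.mul_sum]
  set A := ∫ x in closedBall 0 r, |u x| ^ p
  set B := ∫ x in closedBall 0 r, |lap u x| ^ p
  set Λ := ∫ x in cube n, |TrigData.eval L x| ^ q
  have hA : 0 ≤ A := setIntegral_nonneg hS.isClosed.measurableSet fun x _ => by positivity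
  have hB : 0 ≤ B := setIntegral_nonneg hS.isClosed.measurableSet fun x _ => by positivity
  have hΛ : 0 ≤ Λ := setIntegral_nonneg (measurableSet_cube n) fun x _ => by positivity
  have b1 : |∫ x, η x * lap u x * χ x| ≤ K * (B + C * Λ) :=
    (integral_weight_mul_le hpq hr.le hu.continuous_lap hχ.continuous hK0 h).trans
      (mul_le_mul_of_nonneg_left (add_le_add le_rfl (hM1 i)) hK.le)
  have b2 : |∑ k, ∫ x, partialDeriv' k η x * u x * partialDeriv' k χ x| ≤ n * (K * (A + C * Λ)) := by
    refine (Finset.abs_sum_le_sum_abs _ _).trans ((Finset.sum_le_card_nsmul _ _ (K * (A + C * Λ))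
      fun k _ => ?_).trans (by simp))
    refine (integral_weight_mul_le hpq hr.le hu.continuous
      (hχ.partialDeriv' k).continuous (hK1 k) (h' k)).trans
      (mul_le_mul_of_nonneg_left (add_le_add le_rfl ?_) hK.le)
    rw [hχ_def, TrigData.partialDeriv'_eval]
    exact hM2 k i
  have b3 : |∑ k, ∫ x, hessEntry η k k x * u x * χ x| ≤ n * (K * (A + C * Λ)) := by
    refine (Finset.abs_sum_le_sum_abs _ _).trans ((Finset.sum_le_card_nsmul _ _ (K * (A + C * Λ))
      fun k _ => ?_).trans (by simp))
    exact (integral_weight_mul_le hpq hr.le hu.continuous hχ.continuous (hK2 k) (h'' k k)).trans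
      (mul_le_mul_of_nonneg_left (add_le_add le_rfl (hM1 i)) hK.le)
  have c1 := neg_le_of_abs_le b1
  have c2 := le_of_abs_le b2
  have c3 := le_of_abs_le b3
  have d1 : 0 ≤ K * A := by positivity
  have d2 : 0 ≤ 3 * (n : ℝ) * K * B := by positivity
  linarith

theorem exists_hessian_estimate {p q : ℝ} (hpq : p.HolderConjugate q) {r : ℝ} (hr : r < 1) (n : ℕ) :
    ∃ C > 0, ∀ φ : EuclideanSpace ℝ (Fin n) → ℝ, ContDiff ℝ (⊤ : ℕ∞) φ →
      (∀ x, x ∉ closedBall (0 : EuclideanSpace ℝ (Fin n)) r → φ x = 0) → ∀ i j,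
      ∫ x in cube n, |hessEntry φ i j x| ^ p ≤ C * ∫ x in closedBall 0 r, |lap φ x| ^ p := by
  have hS := isCompact_closedBall (0 : EuclideanSpace ℝ (Fin n)) r
  obtain ⟨C, hC, hpot⟩ := TrigData.exists_lap_potential hpq n
  obtain ⟨D, hD, hdual⟩ := exists_integral_rpow_le_of_dual hpq hC n
  refine ⟨D, hD, fun φ hφ h i j => ?_⟩
  have h'' := hessEntry_eq_zero hS.isClosed h
  refine hdual _ _ (hφ.hessEntry i j).continuous (CubePeriodic.of_closedBall hr (h'' i j))
    fun L => ?_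
  obtain ⟨c, M, hL, hM1, hM2⟩ := hpot L
  simp only [← TrigData.eval_lap] at hL
  set χ := TrigData.eval (TrigData.diff i (TrigData.diff j M)) with hχ_def
  have hχ : ContDiff ℝ (⊤ : ℕ∞) χ := TrigData.contDiff_eval _
  have e0 : ∀ x, hessEntry (TrigData.eval L) j i x = ∑ k, hessEntry χ k k x := fun x => by
    rw [hessEntry, TrigData.partialDeriv'_const_add_eval hL, TrigData.partialDeriv'_eval,
      TrigData.diff_scale, TrigData.diff_scale, TrigData.eval_lap]
    simp only [hχ_def, TrigData.hessEntry_eval]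
  have e1 : ∫ x in cube n, hessEntry φ i j x * TrigData.eval L x =
      ∫ x, Set.indicator (closedBall 0 r) (fun _ => (1 : ℝ)) x * lap φ x * χ x := by
    rw [← integral_eq_setIntegral_cube hr.le fun x hx => mul_eq_zero_of_left (h'' i j x hx) _,
      integral_hessEntry_mul hS hφ (TrigData.contDiff_eval L) h]
    simp only [e0, Finset.mul_sum]
    have i1 : ∀ k, Integrable fun x => φ x * hessEntry χ k k x := fun k =>
      integrable_of_eq_zero hS (hφ.continuous.mul (hχ.hessEntry k k).continuous)
        fun x hx => mul_eq_zero_of_left (h x hx) _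
    have i2 : ∀ k, Integrable fun x => hessEntry φ k k x * χ x := fun k =>
      integrable_of_eq_zero hS ((hφ.hessEntry k k).continuous.mul hχ.continuous)
        fun x hx => mul_eq_zero_of_left (h'' k k x hx) _
    rw [integral_finsetSum _ fun k _ => i1 k]
    simp only [← integral_hessEntry_mul hS hφ hχ h]
    rw [← integral_finsetSum _ fun k _ => i2 k]
    congr 1
    funext x
    by_cases hx : x ∈ closedBall (0 : EuclideanSpace ℝ (Fin n)) r
    · simp [hx, lap, Finset.sum_mul]
    · rw [Set.indicator_of_notMem hx]
      simp [h'' _ _ x hx]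
  rw [e1]
  refine (le_abs_self _).trans ((integral_weight_mul_le hpq hr.le hφ.continuous_lap hχ.continuous
    (K := 1) (fun x => ?_) fun x hx => Set.indicator_of_notMem hx _).trans ?_)
  · by_cases hx : x ∈ closedBall (0 : EuclideanSpace ℝ (Fin n)) r
    · rw [Set.indicator_of_mem hx]; simp
    · rw [Set.indicator_of_notMem hx]; simp
  · rw [one_mul, add_comm]
    exact add_le_add (hM2 i j) le_rfl

end Estimates

section Interior

variable {n : ℕ} {u : EuclideanSpace ℝ (Fin n) → ℝ}

theorem lap_mul {η : EuclideanSpace ℝ (Fin n) → ℝ} (hη : ContDiff ℝ (⊤ : ℕ∞) η)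
    (hu : ContDiff ℝ (⊤ : ℕ∞) u) (x : EuclideanSpace ℝ (Fin n)) :
    lap (fun x => η x * u x) x =
      lap η x * u x + η x * lap u x + 2 * ∑ k, partialDeriv' k η x * partialDeriv' k u x := by
  have h : ∀ k, hessEntry (fun x => η x * u x) k k x = hessEntry η k k x * u x +
      η x * hessEntry u k k x + 2 * (partialDeriv' k η x * partialDeriv' k u x) := fun k => by
    have h1 : partialDeriv' k (fun x => partialDeriv' k η x * u x + η x * partialDeriv' k u x) x =
        partialDeriv' k (fun x => partialDeriv' k η x * u x) x +
          partialDeriv' k (fun x => η x * partialDeriv' k u x) x := by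
      show fderiv ℝ (fun x => partialDeriv' k η x * u x + η x * partialDeriv' k u x) x
        (EuclideanSpace.single k 1) = _
      rw [fderiv_fun_add (((hη.partialDeriv' k).mul hu).differentiable_top x)
        ((hη.mul (hu.partialDeriv' k)).differentiable_top x)]
      rfl
    simp only [hessEntry]
    rw [partialDeriv'_mul hη hu, h1, partialDeriv'_mul (hη.partialDeriv' k) hu,
      partialDeriv'_mul hη (hu.partialDeriv' k)]
    ring
  simp only [lap, h, Finset.sum_add_distrib, Finset.sum_mul, Finset.mul_sum]

/-- A smooth cutoff between two concentric balls. -/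
theorem exists_cutoff (n : ℕ) {r R : ℝ} (hr : 0 < r) (hR : r < R) :
    ∃ η : EuclideanSpace ℝ (Fin n) → ℝ, ContDiff ℝ (⊤ : ℕ∞) η ∧
      (∀ x ∈ closedBall (0 : EuclideanSpace ℝ (Fin n)) r, η x = 1) ∧
      ∀ x, x ∉ closedBall (0 : EuclideanSpace ℝ (Fin n)) R → η x = 0 := by
  let b : ContDiffBump (0 : EuclideanSpace ℝ (Fin n)) := ⟨r, R, hr, hR⟩
  refine ⟨b, b.contDiff, fun x hx => b.one_of_mem_closedBall hx, fun x hx => ?_⟩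
  by_contra hne
  have : x ∈ Function.support b := hne
  rw [b.support_eq] at this
  exact hx (ball_subset_closedBall this)

theorem abs_add_add_sum_rpow_le {p : ℝ} (hp : 1 ≤ p) (a b : ℝ) (c : Fin n → ℝ) :
    |a + b + 2 * ∑ k, c k| ^ p ≤
      2 ^ p * (2 ^ p * (|a| ^ p + |b| ^ p) + 2 ^ p * (n ^ (p - 1) * ∑ k, |c k| ^ p)) := by
  have hp0 : 0 ≤ p := by linarith
  refine (abs_add_rpow_le hp0 _ _).trans (mul_le_mul_of_nonneg_left ?_ (by positivity))
  refine add_le_add (abs_add_rpow_le hp0 _ _) ?_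
  rw [abs_mul, Real.mul_rpow (abs_nonneg _) (abs_nonneg _), abs_two]
  refine mul_le_mul_of_nonneg_left ?_ (by positivity)
  calc _ ≤ (∑ k, |c k|) ^ p :=
        Real.rpow_le_rpow (abs_nonneg _) (Finset.abs_sum_le_sum_abs _ _) hp0
    _ ≤ _ := by
        simpa using Real.rpow_sum_le_const_mul_sum_rpow (Finset.univ : Finset (Fin n)) c hp

/-- Interior estimate for globally smooth functions. -/
theorem exists_interior_estimate {p q : ℝ} (hpq : p.HolderConjugate q) (n : ℕ) :
    ∃ C > 0, ∀ u : EuclideanSpace ℝ (Fin n) → ℝ, ContDiff ℝ (⊤ : ℕ∞) u → ∀ i j,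
      ∫ x in ball 0 (1 / 2), |hessEntry u i j x| ^ p ≤
        C * ((∫ x in closedBall 0 (7 / 8), |u x| ^ p) +
          ∫ x in closedBall 0 (7 / 8), |lap u x| ^ p) := by
  obtain ⟨η, hη, hη1, hη0⟩ := exists_cutoff n (r := 3 / 4) (R := 7 / 8) (by norm_num) (by norm_num)
  obtain ⟨ζ, hζ, hζ1, hζ0⟩ := exists_cutoff n (r := 1 / 2) (R := 5 / 8) (by norm_num) (by norm_num)
  have hS := isCompact_closedBall (0 : EuclideanSpace ℝ (Fin n)) (5 / 8)
  obtain ⟨C₁, hC₁, hgrad⟩ := exists_gradient_estimate hpq (by norm_num) hη hη0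
  obtain ⟨C₂, hC₂, hhess⟩ := exists_hessian_estimate hpq (r := 5 / 8) (by norm_num) n
  obtain ⟨K, hK, hK0, hK1, hK2⟩ := exists_bound_derivatives hS hζ hζ0
  have hp := hpq.lt
  have hlapζ : ∀ x, |lap ζ x| ≤ n * K := fun x =>
    (Finset.abs_sum_le_sum_abs _ _).trans
      ((Finset.sum_le_card_nsmul _ _ K fun k _ => hK2 k x).trans (by simp))
  refine ⟨C₂ * (2 ^ p * (2 ^ p * ((n * K) ^ p + K ^ p) +
    2 ^ p * (n ^ (p - 1) * (n * (K ^ p * C₁))))), by positivity, fun u hu i j => ?_⟩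
  set φ := fun x => ζ x * u x with hφ_def
  set w := fun x => η x * u x with hw_def
  have hφ : ContDiff ℝ (⊤ : ℕ∞) φ := hζ.mul hu
  have hw : ContDiff ℝ (⊤ : ℕ∞) w := hη.mul hu
  have hφ0 : ∀ x, x ∉ closedBall (0 : EuclideanSpace ℝ (Fin n)) (5 / 8) → φ x = 0 :=
    fun x hx => mul_eq_zero_of_left (hζ0 x hx) _
  have hc : ∀ {v : EuclideanSpace ℝ (Fin n) → ℝ}, Continuous v → Continuous fun x => |v x| ^ p :=
    fun hv => hv.abs.rpow_const fun _ => Or.inr hpq.nonneg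
  have hint : ∀ {v : EuclideanSpace ℝ (Fin n) → ℝ} (r : ℝ), Continuous v →
      IntegrableOn (fun x => |v x| ^ p) (closedBall 0 r) := fun r hv =>
    (hc hv).continuousOn.integrableOn_compact (isCompact_closedBall _ _)
  have hpos : ∀ (v : EuclideanSpace ℝ (Fin n) → ℝ) (s : Set (EuclideanSpace ℝ (Fin n))),
      0 ≤ᵐ[volume.restrict s] fun x => |v x| ^ p := fun v s =>
    Filter.Eventually.of_forall fun x => by simp only [Pi.zero_apply]; positivity
  have hmono : ∀ {v : EuclideanSpace ℝ (Fin n) → ℝ}, Continuous v →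
      ∫ x in closedBall 0 (5 / 8), |v x| ^ p ≤ ∫ x in closedBall 0 (7 / 8), |v x| ^ p := fun hv =>
    setIntegral_mono_set (hint _ hv) (hpos _ _)
      (Filter.Eventually.of_forall (closedBall_subset_closedBall (by norm_num)))
  set A := ∫ x in closedBall 0 (7 / 8), |u x| ^ p
  set B := ∫ x in closedBall 0 (7 / 8), |lap u x| ^ p
  have hA : 0 ≤ A := setIntegral_nonneg measurableSet_closedBall fun x _ => by positivity
  have hB : 0 ≤ B := setIntegral_nonneg measurableSet_closedBall fun x _ => by positivity
  have s1 : ∫ x in ball 0 (1 / 2), |hessEntry u i j x| ^ p ≤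
      C₂ * ∫ x in closedBall 0 (5 / 8), |lap φ x| ^ p := by
    calc _ = ∫ x in ball 0 (1 / 2), |hessEntry φ i j x| ^ p := by
          refine setIntegral_congr_fun measurableSet_ball fun x hx => ?_
          have : hessEntry u i j x = hessEntry φ i j x :=
            hessEntry_congr isOpen_ball (fun y hy => by
              rw [hφ_def]
              simp only [hζ1 y (ball_subset_closedBall hy), one_mul]) i j x hx
          simp only [this]
      _ ≤ ∫ x in cube n, |hessEntry φ i j x| ^ p :=
          setIntegral_mono_set (hc (hφ.hessEntry i j).continuous).integrableOn_cube (hpos _ _)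
            (Filter.Eventually.of_forall (ball_subset_closedBall.trans
              (closedBall_subset_cube (by norm_num))))
      _ ≤ _ := hhess φ hφ hφ0 i j
  have pw : ∀ x ∈ closedBall (0 : EuclideanSpace ℝ (Fin n)) (5 / 8), |lap φ x| ^ p ≤
      2 ^ p * (2 ^ p * ((n * K) ^ p * |u x| ^ p + K ^ p * |lap u x| ^ p) +
        2 ^ p * (n ^ (p - 1) * ∑ k, K ^ p * |partialDeriv' k w x| ^ p)) := fun x hx => by
    have hle : ∀ {a b D : ℝ}, |a| ≤ D → |a * b| ^ p ≤ D ^ p * |b| ^ p := fun {a b D} h => by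
      rw [abs_mul, Real.mul_rpow (abs_nonneg _) (abs_nonneg _)]
      exact mul_le_mul_of_nonneg_right (Real.rpow_le_rpow (abs_nonneg _) h hpq.nonneg)
        (by positivity)
    have hx' : x ∈ ball (0 : EuclideanSpace ℝ (Fin n)) (3 / 4) :=
      closedBall_subset_ball (by norm_num) hx
    have hdw : ∀ k, partialDeriv' k u x = partialDeriv' k w x := fun k =>
      partialDeriv'_congr isOpen_ball (fun y hy => by
        rw [hw_def]
        simp only [hη1 y (ball_subset_closedBall hy), one_mul]) k x hx'
    rw [hφ_def, lap_mul hζ hu]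
    refine (abs_add_add_sum_rpow_le hp.le _ _ _).trans ?_
    simp only [hdw]
    gcongr with k
    · exact hle (hlapζ x)
    · exact hle (hK0 x)
    · exact hle (hK1 k x)
  have i1 := (hint (5 / 8) hu.continuous).const_mul ((n * K) ^ p)
  have i2 := (hint (5 / 8) hu.continuous_lap).const_mul (K ^ p)
  have i3 : ∀ k, IntegrableOn (fun x => K ^ p * |partialDeriv' k w x| ^ p) (closedBall 0 (5 / 8)) :=
    fun k => (hint (5 / 8) (hw.partialDeriv' k).continuous).const_mul (K ^ p)
  have i12 : IntegrableOn (fun x => 2 ^ p * ((n * K) ^ p * |u x| ^ p + K ^ p * |lap u x| ^ p))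
      (closedBall 0 (5 / 8)) := (i1.add i2).const_mul _
  have i33 : IntegrableOn (fun x => 2 ^ p * (n ^ (p - 1) * ∑ k, K ^ p * |partialDeriv' k w x| ^ p))
      (closedBall 0 (5 / 8)) :=
    ((integrable_finsetSum _ fun k _ => i3 k).const_mul _).const_mul _
  have s2 : ∫ x in closedBall 0 (5 / 8), |lap φ x| ^ p ≤
      2 ^ p * (2 ^ p * ((n * K) ^ p * A + K ^ p * B) +
        2 ^ p * (n ^ (p - 1) * ∑ k : Fin n, K ^ p * (C₁ * (A + B)))) := by
    refine (setIntegral_mono_on (hint _ hφ.continuous_lap) ((i12.add i33).const_mul (2 ^ p))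
      measurableSet_closedBall pw).trans ?_
    simp only [Pi.add_apply]
    rw [integral_const_mul, integral_add i12 i33, integral_const_mul, integral_const_mul,
      integral_const_mul, integral_add i1 i2, integral_finsetSum _ fun k _ => i3 k]
    simp only [integral_const_mul]
    gcongr with k hk
    · exact hmono hu.continuous
    · exact hmono hu.continuous_lap
    · exact (setIntegral_mono_set (hc (hw.partialDeriv' k).continuous).integrableOn_cube (hpos _ _)
        (Filter.Eventually.of_forall (closedBall_subset_cube (by norm_num)))).trans (hgrad u hu k)
  refine s1.trans ?_
  rw [mul_assoc]
  refine mul_le_mul_of_nonneg_left (s2.trans ?_) hC₂.le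
  rw [Finset.sum_const, Finset.card_univ, Fintype.card_fin, nsmul_eq_mul, mul_assoc]
  refine mul_le_mul_of_nonneg_left ?_ (by positivity)
  have hAB : (n * K) ^ p * A + K ^ p * B ≤ ((n * K) ^ p + K ^ p) * (A + B) := by
    have h1 : 0 ≤ (n * K) ^ p * B := by positivity
    have h2 : 0 ≤ K ^ p * A := by positivity
    linarith
  have h3 := mul_le_mul_of_nonneg_left hAB (by positivity : (0 : ℝ) ≤ 2 ^ p)
  linarith

end Interior

section Localization

variable {n : ℕ}

theorem contDiff_cutoff_mul {u η : EuclideanSpace ℝ (Fin n) → ℝ} {r R : ℝ} (hrR : r < R)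
    (hu : ContDiffOn ℝ (⊤ : ℕ∞) u (ball 0 R)) (hη : ContDiff ℝ (⊤ : ℕ∞) η)
    (hη0 : ∀ x, x ∉ closedBall (0 : EuclideanSpace ℝ (Fin n)) r → η x = 0) :
    ContDiff ℝ (⊤ : ℕ∞) fun x => η x * u x := by
  refine contDiff_iff_contDiffAt.2 fun x => ?_
  by_cases hx : x ∈ ball (0 : EuclideanSpace ℝ (Fin n)) R
  · exact hη.contDiffAt.mul (hu.contDiffAt (isOpen_ball.mem_nhds hx))
  · have hx' : x ∈ (closedBall (0 : EuclideanSpace ℝ (Fin n)) r)ᶜ := fun h =>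
      hx (closedBall_subset_ball hrR h)
    refine (contDiffAt_const (c := (0 : ℝ))).congr_of_eventuallyEq ?_
    filter_upwards [isClosed_closedBall.isOpen_compl.mem_nhds hx'] with y hy
    rw [hη0 y hy, zero_mul]

theorem sqrt_hessFrobSq_rpow_le {p : ℝ} (hp : 1 ≤ p) (u : EuclideanSpace ℝ (Fin n) → ℝ)
    (x : EuclideanSpace ℝ (Fin n)) :
    Real.sqrt (hessFrobSq u x) ^ p ≤
      ((n * n : ℕ) : ℝ) ^ (p - 1) * ∑ i, ∑ j, |hessEntry u i j x| ^ p := by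
  have h : Real.sqrt (hessFrobSq u x) ≤ ∑ ij : Fin n × Fin n, |hessEntry u ij.1 ij.2 x| := by
    rw [Real.sqrt_le_left (Finset.sum_nonneg fun _ _ => abs_nonneg _), hessFrobSq,
      ← Fintype.sum_prod_type']
    calc _ = ∑ ij : Fin n × Fin n, |hessEntry u ij.1 ij.2 x| ^ 2 := by simp only [sq_abs]
      _ ≤ _ := Finset.sum_sq_le_sq_sum_of_nonneg fun _ _ => abs_nonneg _
  refine (Real.rpow_le_rpow (Real.sqrt_nonneg _) h (by linarith)).trans ?_
  rw [← Fintype.sum_prod_type' (f := fun i j => |hessEntry u i j x| ^ p)]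
  simpa using Real.rpow_sum_le_const_mul_sum_rpow (Finset.univ : Finset (Fin n × Fin n))
    (fun ij => hessEntry u ij.1 ij.2 x) hp

theorem ofReal_integral_closedBall_le {v g : EuclideanSpace ℝ (Fin n) → ℝ} {p r R : ℝ}
    (hp : 0 ≤ p) (hrR : r < R) (hv : Continuous v)
    (h : ∀ x ∈ closedBall (0 : EuclideanSpace ℝ (Fin n)) r, v x = g x) :
    ENNReal.ofReal (∫ x in closedBall 0 r, |v x| ^ p) ≤
      ∫⁻ x in ball 0 R, ENNReal.ofReal (|g x| ^ p) := by
  have hc : Continuous fun x => |v x| ^ p := hv.abs.rpow_const fun _ => Or.inr hp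
  rw [ofReal_integral_eq_lintegral_ofReal
    (hc.continuousOn.integrableOn_compact (isCompact_closedBall _ _))
    (Filter.Eventually.of_forall fun x => by simp only [Pi.zero_apply]; positivity)]
  calc _ = ∫⁻ x in closedBall 0 r, ENNReal.ofReal (|g x| ^ p) :=
        setLIntegral_congr_fun measurableSet_closedBall fun x hx => by simp only [h x hx]
    _ ≤ _ := lintegral_mono_set (closedBall_subset_ball hrR)

end Localization

/-- Interior Calderón–Zygmund `W^{2,p}` estimate for the Laplacian, `1 < p < ∞`. -/
theorem calderon_zygmund_elliptic (n : ℕ) (hn : 1 ≤ n) (p : ℝ) (hp : 1 < p) :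
    ∃ C : ℝ, 0 < C ∧
      ∀ u f : EuclideanSpace ℝ (Fin n) → ℝ,
        ContDiffOn ℝ (⊤ : ℕ∞) u (ball (0 : EuclideanSpace ℝ (Fin n)) 1) →
        ContDiffOn ℝ (⊤ : ℕ∞) f (ball (0 : EuclideanSpace ℝ (Fin n)) 1) →
        (∀ x ∈ ball (0 : EuclideanSpace ℝ (Fin n)) 1, lap u x = f x) →
        ∫⁻ x in ball (0 : EuclideanSpace ℝ (Fin n)) (1/2),
            ENNReal.ofReal (Real.sqrt (hessFrobSq u x) ^ p) ≤
          ENNReal.ofReal C *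
            ((∫⁻ x in ball (0 : EuclideanSpace ℝ (Fin n)) 1,
                ENNReal.ofReal (|u x| ^ p)) +
             (∫⁻ x in ball (0 : EuclideanSpace ℝ (Fin n)) 1,
                ENNReal.ofReal (|f x| ^ p))) := by
  obtain ⟨C, hC, hest⟩ := exists_interior_estimate (Real.HolderConjugate.conjExponent hp) n
  obtain ⟨η, hη, hη1, hη0⟩ :=
    exists_cutoff n (r := 15 / 16) (R := 31 / 32) (by norm_num) (by norm_num)
  have hp0 : 0 ≤ p := by linarith
  have hn0 : (0 : ℝ) < n := by exact_mod_cast hn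
  refine ⟨((n * n : ℕ) : ℝ) ^ (p - 1) * (n * (n * C)), by push_cast; positivity,
    fun u f hu _ huf => ?_⟩
  have hw : ContDiff ℝ (⊤ : ℕ∞) fun x => η x * u x :=
    contDiff_cutoff_mul (by norm_num) hu hη hη0
  set w := fun x => η x * u x with hw_def
  have hwu : ∀ x ∈ ball (0 : EuclideanSpace ℝ (Fin n)) (15 / 16), w x = u x := fun x hx => by
    rw [hw_def]
    simp only [hη1 x (ball_subset_closedBall hx), one_mul]
  have hhess : ∀ i j, ∀ x ∈ ball (0 : EuclideanSpace ℝ (Fin n)) (15 / 16),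
      hessEntry w i j x = hessEntry u i j x := fun i j => hessEntry_congr isOpen_ball hwu i j
  have hsub : closedBall (0 : EuclideanSpace ℝ (Fin n)) (7 / 8) ⊆ ball 0 (15 / 16) :=
    closedBall_subset_ball (by norm_num)
  have hU := ofReal_integral_closedBall_le hp0 (by norm_num : (7 / 8 : ℝ) < 1) hw.continuous
    fun x hx => hwu x (hsub hx)
  have hF := ofReal_integral_closedBall_le (g := f) hp0 (by norm_num : (7 / 8 : ℝ) < 1)
    hw.continuous_lap fun x hx => by
      rw [← huf x (ball_subset_ball (by norm_num) (hsub hx))]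
      exact Finset.sum_congr rfl fun i _ => hhess i i x (hsub hx)
  set A := ∫ x in closedBall 0 (7 / 8), |w x| ^ p
  set B := ∫ x in closedBall 0 (7 / 8), |lap w x| ^ p
  have hA : 0 ≤ A := setIntegral_nonneg measurableSet_closedBall fun x _ => by positivity
  have hB : 0 ≤ B := setIntegral_nonneg measurableSet_closedBall fun x _ => by positivity
  have hint : ∀ i j, IntegrableOn (fun x => |hessEntry w i j x| ^ p)
      (ball (0 : EuclideanSpace ℝ (Fin n)) (1 / 2)) := fun i j =>
    (((hw.hessEntry i j).continuous.abs.rpow_const fun _ => Or.inr hp0).continuousOn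
      |>.integrableOn_compact (isCompact_closedBall 0 (1 / 2))).mono_set ball_subset_closedBall
  have hsum : IntegrableOn (fun x => ((n * n : ℕ) : ℝ) ^ (p - 1) *
      ∑ i, ∑ j, |hessEntry w i j x| ^ p) (ball (0 : EuclideanSpace ℝ (Fin n)) (1 / 2)) :=
    (integrable_finsetSum _ fun i _ => integrable_finsetSum _ fun j _ => hint i j).const_mul _
  calc ∫⁻ x in ball 0 (1 / 2), ENNReal.ofReal (Real.sqrt (hessFrobSq u x) ^ p)
      ≤ ∫⁻ x in ball 0 (1 / 2), ENNReal.ofReal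
          (((n * n : ℕ) : ℝ) ^ (p - 1) * ∑ i, ∑ j, |hessEntry w i j x| ^ p) := by
        refine setLIntegral_mono' measurableSet_ball fun x hx => ENNReal.ofReal_le_ofReal ?_
        refine (sqrt_hessFrobSq_rpow_le hp.le u x).trans_eq ?_
        simp only [fun i j => hhess i j x (ball_subset_ball (by norm_num) hx)]
    _ = ENNReal.ofReal (∫ x in ball 0 (1 / 2),
          ((n * n : ℕ) : ℝ) ^ (p - 1) * ∑ i, ∑ j, |hessEntry w i j x| ^ p) :=
        (ofReal_integral_eq_lintegral_ofReal hsum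
          (Filter.Eventually.of_forall fun x => by simp only [Pi.zero_apply]; positivity)).symm
    _ ≤ ENNReal.ofReal (((n * n : ℕ) : ℝ) ^ (p - 1) * (n * (n * C)) * (A + B)) := by
        refine ENNReal.ofReal_le_ofReal ?_
        rw [integral_const_mul, integral_finsetSum _ fun i _ =>
          integrable_finsetSum _ fun j _ => hint i j, mul_assoc]
        refine mul_le_mul_of_nonneg_left ?_ (by positivity)
        calc _ ≤ ∑ _i : Fin n, ∑ _j : Fin n, C * (A + B) := by
              refine Finset.sum_le_sum fun i _ => ?_
              rw [integral_finsetSum _ fun j _ => hint i j]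
              exact Finset.sum_le_sum fun j _ => hest w hw i j
          _ = _ := by
              simp only [Finset.sum_const, Finset.card_univ, Fintype.card_fin, nsmul_eq_mul]
              ring
    _ ≤ _ := by
        rw [ENNReal.ofReal_mul (by positivity), ENNReal.ofReal_add hA hB]
        gcongr
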